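/- arXiv:2009.02145 — 4 statements merged into one kernel-verified Lean document; each statement's English description precedes it below -/
import Mathlib

section
/- Let 0 < q < ∞ and let T be a linear operator which is a contraction on the couple (L_0, L_q). Then for every f ∈ L_0 + L_q and every t > 0, ∫_t^∞ μ(s, Tf)^q ds ≤ ∫_t^∞ μ(s, f)^q ds; that is, |Tf|^q ≺≺_tl |f|^q. -/
open MeasureTheory ENNReal Set Filter

noncomputable section

namespace CSZ

/-- Lebesgue measure on the half line `(0,∞)`. -/
def m0 : Measure ℝ := volume.restrict (Set.Ioi (0:ℝ))

/-- The right-continuous decreasing rearrangement `μ(t,f)` of a function on `(0,∞)`: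
`μ(t,f) = inf {s ≥ 0 : m({|f| > s}) ≤ t}`. -/
def mu (f : ℝ → ℝ) (t : ℝ) : ℝ :=
  sInf {s : ℝ | 0 ≤ s ∧ m0 {x | s < |f x|} ≤ ENNReal.ofReal t}

/-- Head majorization `g ≺≺_hd f` : `∫_0^t μ(s,g) ds ≤ ∫_0^t μ(s,f) ds` for all `t > 0`. -/
def HeadMaj (g f : ℝ → ℝ) : Prop :=
  ∀ t : ℝ, 0 < t →
    ∫⁻ s in Set.Ioc (0:ℝ) t, ENNReal.ofReal (mu g s) ≤
      ∫⁻ s in Set.Ioc (0:ℝ) t, ENNReal.ofReal (mu f s)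

/-- Tail majorization `g ≺≺_tl f` : `∫_t^∞ μ(s,g) ds ≤ ∫_t^∞ μ(s,f) ds` for all `t > 0`. -/
def TailMaj (g f : ℝ → ℝ) : Prop :=
  ∀ t : ℝ, 0 < t →
    ∫⁻ s in Set.Ioi t, ENNReal.ofReal (mu g s) ≤
      ∫⁻ s in Set.Ioi t, ENNReal.ofReal (mu f s)

/-- The space `L_p(0,∞)`, `0 < p < ∞`. -/
def LpS (p : ℝ) : Set (ℝ → ℝ) :=
  {f | Measurable f ∧ ∫⁻ x, ENNReal.ofReal (|f x| ^ p) ∂m0 < ⊤}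

/-- The `L_p`-norm. -/
def LpNorm (p : ℝ) (f : ℝ → ℝ) : ℝ :=
  ((∫⁻ x, ENNReal.ofReal (|f x| ^ p) ∂m0) ^ (1/p)).toReal

/-- The space `L_∞(0,∞)`. -/
def LinftyS : Set (ℝ → ℝ) :=
  {f | Measurable f ∧ ∃ C : ℝ, ∀ᵐ x ∂m0, |f x| ≤ C}

/-- The `L_∞`-norm (essential supremum). -/
def LinftyNorm (f : ℝ → ℝ) : ℝ :=
  (essSup (fun x => ENNReal.ofReal |f x|) m0).toReal

/-- The space `L_0(0,∞)` of measurable functions with support of finite measure. -/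
def L0S : Set (ℝ → ℝ) :=
  {f | Measurable f ∧ m0 (Function.support f) < ⊤}

/-- The group "norm" on `L_0` : `‖f‖_0 = m(supp f)`. -/
def L0Norm (f : ℝ → ℝ) : ℝ := (m0 (Function.support f)).toReal

/-- The sum `X + Y` of two sets of functions. -/
def sumSet (X Y : Set (ℝ → ℝ)) : Set (ℝ → ℝ) :=
  {f | ∃ g ∈ X, ∃ h ∈ Y, f = g + h}

/-- A quasi-Banach function space on `(0,∞)` : a linear space of measurable functions,
equipped with a complete quasi-norm, such that `f ∈ E`, `g` measurable and `|g| ≤ |f|`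
imply `g ∈ E` and `‖g‖_E ≤ ‖f‖_E`. -/
structure QBFS where
  carrier : Set (ℝ → ℝ)
  qnorm : (ℝ → ℝ) → ℝ
  measurable_mem : ∀ f ∈ carrier, Measurable f
  zero_mem : (0 : ℝ → ℝ) ∈ carrier
  add_mem : ∀ f ∈ carrier, ∀ g ∈ carrier, f + g ∈ carrier
  smul_mem : ∀ (c : ℝ), ∀ f ∈ carrier, c • f ∈ carrier
  qnorm_nonneg : ∀ f, 0 ≤ qnorm f
  qnorm_eq_zero : ∀ f ∈ carrier, qnorm f = 0 → f = 0
  qnorm_smul : ∀ (c : ℝ) (f : ℝ → ℝ), qnorm (c • f) = |c| * qnorm f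
  quasi_triangle : ∃ C : ℝ, 1 ≤ C ∧ ∀ f g, qnorm (f + g) ≤ C * (qnorm f + qnorm g)
  ideal : ∀ f ∈ carrier, ∀ g : ℝ → ℝ, Measurable g →
    (∀ x, |g x| ≤ |f x|) → g ∈ carrier ∧ qnorm g ≤ qnorm f
  complete : ∀ u : ℕ → ℝ → ℝ, (∀ n, u n ∈ carrier) →
    (∀ ε : ℝ, 0 < ε → ∃ N : ℕ, ∀ j ≥ N, ∀ k ≥ N, qnorm (u j - u k) < ε) →
    ∃ f ∈ carrier, ∀ ε : ℝ, 0 < ε → ∃ N : ℕ, ∀ n ≥ N, qnorm (u n - f) < ε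

/-- `T` is linear on the subspace `S`. -/
def IsLinearOn (T : (ℝ → ℝ) → (ℝ → ℝ)) (S : Set (ℝ → ℝ)) : Prop :=
  (∀ f ∈ S, ∀ g ∈ S, T (f + g) = T f + T g) ∧
  (∀ (c : ℝ), ∀ f ∈ S, T (c • f) = c • T f)

/-- `T` maps `X` into `X` with bound `M` for the (quasi-)norm `N`. -/
def BoundedWith (T : (ℝ → ℝ) → (ℝ → ℝ)) (X : Set (ℝ → ℝ)) (N : (ℝ → ℝ) → ℝ) (M : ℝ) :
    Prop :=
  ∀ f ∈ X, T f ∈ X ∧ N (T f) ≤ M * N f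

/-- `T` maps `X` into `X` boundedly for the (quasi-)norm `N`. -/
def BoundedOn (T : (ℝ → ℝ) → (ℝ → ℝ)) (X : Set (ℝ → ℝ)) (N : (ℝ → ℝ) → ℝ) : Prop :=
  ∃ M : ℝ, 0 ≤ M ∧ BoundedWith T X N M

/-- `(E, NE)` is an interpolation space for the couple `((X,NX), (Y,NY))` :
`X ∩ Y ⊆ E ⊆ X + Y` and every linear operator on `X + Y` which is bounded from `X` to `X`
and from `Y` to `Y` maps `E` into `E` boundedly. -/
def IsInterpolation (X Y : Set (ℝ → ℝ)) (NX NY : (ℝ → ℝ) → ℝ)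
    (E : Set (ℝ → ℝ)) (NE : (ℝ → ℝ) → ℝ) : Prop :=
  X ∩ Y ⊆ E ∧ E ⊆ sumSet X Y ∧
  ∀ T : (ℝ → ℝ) → (ℝ → ℝ),
    IsLinearOn T (sumSet X Y) →
    (∀ f ∈ sumSet X Y, T f ∈ sumSet X Y) →
    BoundedOn T X NX → BoundedOn T Y NY →
    BoundedOn T E NE

lemma setOf_lt_abs_measurable {f : ℝ → ℝ} (hf : Measurable f) (l : ℝ) :
    MeasurableSet {x | l < |f x|} :=
  measurableSet_lt measurable_const hf.abs

/-- A function in `L_0 + L_q` has finite distribution function on `(0,∞)`. -/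
lemma meas_lt_abs_lt_top {q : ℝ} (hq : 0 < q) {f : ℝ → ℝ}
    (hf : f ∈ sumSet L0S (LpS q)) {l : ℝ} (hl : 0 < l) :
    m0 {x | l < |f x|} < ⊤ := by
  obtain ⟨g, ⟨-, hg⟩, h, ⟨hhm, hh⟩, rfl⟩ := hf
  have hsub : {x | l < |(g + h) x|} ⊆
      Function.support g ∪ {x | ENNReal.ofReal (l ^ q) ≤ ENNReal.ofReal (|h x| ^ q)} := by
    intro x hx
    by_cases hgx : g x = 0
    · right
      simp only [mem_ofPred_eq, Pi.add_apply, hgx, zero_add] at hx ⊢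
      exact ENNReal.ofReal_le_ofReal (Real.rpow_le_rpow hl.le hx.le hq.le)
    · exact Or.inl hgx
  refine (measure_mono hsub).trans_lt ((measure_union_le _ _).trans_lt
    (ENNReal.add_lt_top.2 ⟨hg, ?_⟩))
  have hpos : ENNReal.ofReal (l ^ q) ≠ 0 := by
    simpa using Real.rpow_pos_of_pos hl q
  refine (meas_ge_le_lintegral_div ?_ hpos ENNReal.ofReal_ne_top).trans_lt
    (ENNReal.div_lt_top hh.ne hpos)
  exact (hhm.abs.pow_const q).ennreal_ofReal.aemeasurable

section Rearrangement

variable {f : ℝ → ℝ}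

lemma exists_meas_lt_abs_le (hf : Measurable f)
    (hfin : ∀ l : ℝ, 0 < l → m0 {x | l < |f x|} < ⊤) {s : ℝ} (hs : 0 < s) :
    ∃ l : ℝ, 0 ≤ l ∧ m0 {x | l < |f x|} ≤ ENNReal.ofReal s := by
  have hanti : Antitone fun n : ℕ => {x | (n : ℝ) < |f x|} := fun a b hab x
    (hx : (b : ℝ) < |f x|) => lt_of_le_of_lt (Nat.cast_le.2 hab) hx
  have hlim := tendsto_measure_iInter_atTop (μ := m0)
    (fun n : ℕ => (setOf_lt_abs_measurable hf n).nullMeasurableSet) hanti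
    ⟨1, (hfin _ (by simp)).ne⟩
  have hempty : (⋂ n : ℕ, {x | (n : ℝ) < |f x|}) = ∅ := by
    ext x
    obtain ⟨n, hn⟩ := exists_nat_ge |f x|
    simp only [mem_iInter, mem_ofPred_eq, mem_empty_iff_false, iff_false, not_forall, not_lt]
    exact ⟨n, hn⟩
  rw [hempty, measure_empty] at hlim
  obtain ⟨n, hn⟩ := (hlim.eventually_lt_const (ENNReal.ofReal_pos.2 hs)).exists
  exact ⟨n, n.cast_nonneg, hn.le⟩

lemma mu_nonneg (f : ℝ → ℝ) (s : ℝ) : 0 ≤ mu f s :=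
  Real.sInf_nonneg fun _ h => h.1

lemma mu_le {l s : ℝ} (hl : 0 ≤ l) (h : m0 {x | l < |f x|} ≤ ENNReal.ofReal s) :
    mu f s ≤ l :=
  csInf_le ⟨0, fun _ h => h.1⟩ ⟨hl, h⟩

lemma meas_mu_lt_abs_le (hf : Measurable f)
    (hfin : ∀ l : ℝ, 0 < l → m0 {x | l < |f x|} < ⊤) {s : ℝ} (hs : 0 < s) :
    m0 {x | mu f s < |f x|} ≤ ENNReal.ofReal s := by
  obtain ⟨u, hu, hul, hlim⟩ := exists_seq_strictAnti_tendsto (mu f s)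
  have hmono : Monotone fun n : ℕ => {x | u n < |f x|} := fun a b hab x hx =>
    lt_of_le_of_lt (hu.antitone hab) hx
  have hunion : (⋃ n : ℕ, {x | u n < |f x|}) = {x | mu f s < |f x|} := by
    ext x
    simp only [mem_iUnion, mem_ofPred_eq]
    exact ⟨fun ⟨n, hn⟩ => (hul n).trans hn, fun hx => (hlim.eventually_lt_const hx).exists⟩
  rw [← hunion, hmono.measure_iUnion]
  refine iSup_le fun n => ?_
  obtain ⟨l, hl, hlu⟩ := exists_lt_of_csInf_lt (exists_meas_lt_abs_le hf hfin hs) (hul n)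
  exact (measure_mono fun x hx => hlu.trans hx).trans hl.2

lemma lt_mu_iff (hf : Measurable f)
    (hfin : ∀ l : ℝ, 0 < l → m0 {x | l < |f x|} < ⊤) {s l : ℝ} (hs : 0 < s) (hl : 0 ≤ l) :
    l < mu f s ↔ ENNReal.ofReal s < m0 {x | l < |f x|} := by
  rw [← not_le, ← not_le, not_iff_not]
  exact ⟨fun h => (measure_mono fun x hx => h.trans_lt hx).trans (meas_mu_lt_abs_le hf hfin hs),
    mu_le hl⟩

lemma mu_antitoneOn (hf : Measurable f)
    (hfin : ∀ l : ℝ, 0 < l → m0 {x | l < |f x|} < ⊤) : AntitoneOn (mu f) (Ioi 0) :=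
  fun _ ha _ _ hab => mu_le (mu_nonneg f _)
    ((meas_mu_lt_abs_le hf hfin ha).trans (ENNReal.ofReal_le_ofReal hab))

lemma volume_ofReal_lt_inter_Ioi {t : ℝ} (ht : 0 < t) (D : ℝ≥0∞) :
    volume ({s : ℝ | ENNReal.ofReal s < D} ∩ Ioi t) = D - ENNReal.ofReal t := by
  by_cases hD : D = ⊤
  · simp [hD]
  · lift D to NNReal using hD
    have : {s : ℝ | ENNReal.ofReal s < D} ∩ Ioi t = Ioo t D := by
      ext s
      simp only [mem_inter_iff, mem_ofPred_eq, mem_Ioi, mem_Ioo]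
      rw [and_comm]
      refine and_congr_right fun hs => ?_
      rw [← ENNReal.ofReal_coe_nnreal, ENNReal.ofReal_lt_ofReal_iff']
      exact ⟨fun h => h.1, fun h => ⟨h, (ht.trans hs).trans h⟩⟩
    rw [this, Real.volume_Ioo, ENNReal.ofReal_sub _ ht.le, ENNReal.ofReal_coe_nnreal]

/-- The layer-cake formula for the tail integral of a decreasing rearrangement. -/
lemma lintegral_tail_mu_rpow {q : ℝ} (hq : 0 < q) (hf : Measurable f)
    (hfin : ∀ l : ℝ, 0 < l → m0 {x | l < |f x|} < ⊤) {t : ℝ} (ht : 0 < t) :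
    ∫⁻ s in Ioi t, ENNReal.ofReal (mu f s ^ q) =
      ENNReal.ofReal q * ∫⁻ l in Ioi 0,
        (m0 {x | l < |f x|} - ENNReal.ofReal t) * ENNReal.ofReal (l ^ (q - 1)) := by
  rw [lintegral_rpow_eq_lintegral_meas_lt_mul _ (ae_of_all _ (mu_nonneg f))
    (aemeasurable_restrict_of_antitoneOn measurableSet_Ioi
      ((mu_antitoneOn hf hfin).mono (Ioi_subset_Ioi ht.le))) hq]
  congr 1
  refine setLIntegral_congr_fun measurableSet_Ioi fun l hl => ?_
  congr 1
  rw [Measure.restrict_apply' measurableSet_Ioi, ← volume_ofReal_lt_inter_Ioi ht]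
  congr 1
  ext s
  exact and_congr_left fun hs => lt_mu_iff hf hfin (ht.trans hs) (le_of_lt hl)

/-- Removing a part supported on a set of measure at most `t` does not decrease the
`q`-norm below the tail integral. -/
lemma lintegral_tail_mu_add_le {q : ℝ} (hq : 0 < q) {g h : ℝ → ℝ} (hh : Measurable h)
    (hf : Measurable (g + h))
    (hfin : ∀ l : ℝ, 0 < l → m0 {x | l < |(g + h) x|} < ⊤) {t : ℝ} (ht : 0 < t)
    (hg : m0 (Function.support g) ≤ ENNReal.ofReal t) :
    ∫⁻ s in Ioi t, ENNReal.ofReal (mu (g + h) s ^ q) ≤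
      ∫⁻ x, ENNReal.ofReal (|h x| ^ q) ∂m0 := by
  rw [lintegral_tail_mu_rpow hq hf hfin ht,
    lintegral_rpow_eq_lintegral_meas_lt_mul _ (ae_of_all _ fun x => abs_nonneg (h x))
      hh.abs.aemeasurable hq]
  gcongr with l
  rw [tsub_le_iff_left]
  refine (measure_mono ?_).trans ((measure_union_le (Function.support g) _).trans
    (add_le_add_left hg _))
  intro x hx
  by_cases hgx : g x = 0
  · right
    simpa [hgx] using hx
  · exact Or.inl hgx

end Rearrangement

/-- Intermediate value property of the measure `m0`. -/
lemma exists_measurableSet_between {B C : Set ℝ} (hB : MeasurableSet B) (hC : MeasurableSet C)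
    (hBC : B ⊆ C) (hCfin : m0 C ≠ ⊤) {t : ℝ} (ht : 0 ≤ t)
    (hBt : m0 B ≤ ENNReal.ofReal t) (htC : ENNReal.ofReal t ≤ m0 C) :
    ∃ A, MeasurableSet A ∧ B ⊆ A ∧ A ⊆ C ∧ m0 A = ENNReal.ofReal t := by
  rcases htC.eq_or_lt with h | h
  · exact ⟨C, hC, hBC, Subset.rfl, h.symm⟩
  let S : ℝ → Set ℝ := fun r => B ∪ (C ∩ Iic r)
  have hSC : ∀ r, S r ⊆ C := fun r => union_subset hBC inter_subset_left
  have hSfin : ∀ r, m0 (S r) ≠ ⊤ := fun r => ne_top_of_le_ne_top hCfin (measure_mono (hSC r))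
  have hmono : Monotone S := fun a b hab =>
    union_subset_union_right _ (inter_subset_inter_right _ (Iic_subset_Iic.2 hab))
  have hcont : Continuous fun r => m0.real (S r) := by
    refine (LipschitzWith.of_le_add (f := fun r => m0.real (S r)) fun a b => ?_).continuous
    have hsub : S a ⊆ S b ∪ Icc b a := by
      rintro x (hx | ⟨hx, hxa⟩)
      · exact Or.inl (Or.inl hx)
      · rcases le_total x b with hxb | hxb
        · exact Or.inl (Or.inr ⟨hx, hxb⟩)
        · exact Or.inr ⟨hxb, hxa⟩
    have hIcc : m0 (Icc b a) ≤ ENNReal.ofReal (dist a b) :=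
      (Measure.restrict_apply_le _ _).trans (by
        rw [Real.volume_Icc]
        exact ENNReal.ofReal_le_ofReal (le_abs_self _))
    have hle : m0 (S a) ≤ ENNReal.ofReal (m0.real (S b) + dist a b) := by
      rw [ENNReal.ofReal_add measureReal_nonneg dist_nonneg, ofReal_measureReal (hSfin b)]
      exact (measure_mono hsub).trans ((measure_union_le _ _).trans (add_le_add_right hIcc _))
    exact ENNReal.toReal_le_of_le_ofReal (add_nonneg measureReal_nonneg dist_nonneg) hle
  have hzero : m0.real (S 0) ≤ t := by
    refine ENNReal.toReal_le_of_le_ofReal ht ((measure_union_le _ _).trans ?_)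
    have : m0 (C ∩ Iic 0) = 0 := by
      refine measure_mono_null inter_subset_right ?_
      rw [m0, Measure.restrict_apply measurableSet_Iic, inter_comm, Ioi_inter_Iic, Ioc_self,
        measure_empty]
    rwa [this, add_zero]
  have hlarge : ∃ r, t ≤ m0.real (S r) := by
    have hlim := tendsto_measure_iUnion_atTop (μ := m0) hmono
    have hU : (⋃ r, S r) = C :=
      Subset.antisymm (iUnion_subset hSC) fun x hx => mem_iUnion.2 ⟨x, Or.inr ⟨hx, self_mem_Iic⟩⟩
    rw [hU] at hlim
    obtain ⟨r, hr⟩ := (hlim.eventually_const_lt h).exists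
    exact ⟨r, (ENNReal.ofReal_le_iff_le_toReal (hSfin r)).1 hr.le⟩
  obtain ⟨r, hr⟩ := mem_range_of_exists_le_of_exists_ge hcont ⟨0, hzero⟩ hlarge
  refine ⟨S r, hB.union (hC.inter measurableSet_Iic), subset_union_left, hSC r, ?_⟩
  rw [← ofReal_measureReal (hSfin r)]
  exact congrArg ENNReal.ofReal hr

/-- The set carrying the `t` largest values of `|f|`. -/
lemma exists_superlevel_set {f : ℝ → ℝ} (hf : Measurable f)
    (hfin : ∀ l : ℝ, 0 < l → m0 {x | l < |f x|} < ⊤) {t : ℝ} (ht : 0 < t) :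
    ∃ A, MeasurableSet A ∧ m0 A ≤ ENNReal.ofReal t ∧ {x | mu f t < |f x|} ⊆ A ∧
      ∀ l, 0 ≤ l → l < mu f t → A ⊆ {x | l < |f x|} ∧ m0 A = ENNReal.ofReal t := by
  have hB := meas_mu_lt_abs_le hf hfin ht
  rcases (mu_nonneg f t).eq_or_lt with h0 | hpos
  · exact ⟨_, setOf_lt_abs_measurable hf _, hB, Subset.rfl, fun l hl hl' => by linarith⟩
  obtain ⟨u, hu, hul, hlim⟩ := exists_seq_strictMono_tendsto' hpos
  have hanti : Antitone fun n : ℕ => {x | u n < |f x|} := fun a b hab x hx =>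
    lt_of_le_of_lt (hu.monotone hab) hx
  have hInter : (⋂ n : ℕ, {x | u n < |f x|}) = {x | mu f t ≤ |f x|} := by
    ext x
    simp only [mem_iInter, mem_ofPred_eq]
    exact ⟨fun hx => le_of_tendsto' hlim fun n => (hx n).le,
      fun hx n => (hul n).2.trans_le hx⟩
  have hge := tendsto_measure_iInter_atTop (μ := m0)
    (fun n : ℕ => (setOf_lt_abs_measurable hf (u n)).nullMeasurableSet) hanti
    ⟨0, (hfin _ (hul 0).1).ne⟩
  rw [hInter] at hge
  have htC : ENNReal.ofReal t ≤ m0 {x | mu f t ≤ |f x|} :=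
    ge_of_tendsto' hge fun n => ((lt_mu_iff hf hfin ht (hul n).1.le).1 (hul n).2).le
  have hCfin : m0 {x | mu f t ≤ |f x|} ≠ ⊤ :=
    ((measure_mono fun x hx => (half_lt_self hpos).trans_le hx).trans_lt
      (hfin _ (half_pos hpos))).ne
  obtain ⟨A, hA, hBA, hAC, hAt⟩ := exists_measurableSet_between
    (setOf_lt_abs_measurable hf _) (measurableSet_le measurable_const hf.abs)
    (fun x (hx : mu f t < |f x|) => hx.le) hCfin ht.le hB htC
  exact ⟨A, hA, hAt.le, hBA, fun l _ hl => ⟨fun x hx => hl.trans_le (hAC hx), hAt⟩⟩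

/-- Splitting off the `t` largest values of `|f|` leaves a remainder whose `q`-norm is
controlled by the tail integral. -/
lemma exists_decomposition {q : ℝ} (hq : 0 < q) {f : ℝ → ℝ} (hf : Measurable f)
    (hfin : ∀ l : ℝ, 0 < l → m0 {x | l < |f x|} < ⊤) {t : ℝ} (ht : 0 < t) :
    ∃ g h : ℝ → ℝ, Measurable g ∧ Measurable h ∧ f = g + h ∧
      m0 (Function.support g) ≤ ENNReal.ofReal t ∧
      ∫⁻ x, ENNReal.ofReal (|h x| ^ q) ∂m0 ≤ ∫⁻ s in Ioi t, ENNReal.ofReal (mu f s ^ q) := by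
  obtain ⟨A, hA, hAt, hBA, hlow⟩ := exists_superlevel_set hf hfin ht
  have hhm : Measurable (Aᶜ.indicator f) := hf.indicator hA.compl
  refine ⟨A.indicator f, Aᶜ.indicator f, hf.indicator hA, hhm,
    (indicator_self_add_compl A f).symm,
    (measure_mono support_indicator_subset).trans hAt, ?_⟩
  rw [lintegral_tail_mu_rpow hq hf hfin ht,
    lintegral_rpow_eq_lintegral_meas_lt_mul _ (ae_of_all _ fun x => abs_nonneg _)
      hhm.abs.aemeasurable hq]
  refine mul_le_mul_right (setLIntegral_mono' measurableSet_Ioi fun l hl => ?_) _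
  refine mul_le_mul_left ?_ _
  have hl0 : (0 : ℝ) < l := hl
  have hsub : {x | l < |Aᶜ.indicator f x|} ⊆ {x | l < |f x|} \ A := by
    intro x hx
    by_cases hxA : x ∈ A
    · simp only [mem_ofPred_eq, indicator_of_notMem (notMem_compl_iff.2 hxA), abs_zero] at hx
      exact absurd hx hl0.not_gt
    · simp only [mem_ofPred_eq, indicator_of_mem (mem_compl hxA)] at hx
      exact ⟨hx, hxA⟩
  refine (measure_mono hsub).trans ?_
  rcases lt_or_ge l (mu f t) with hlt | hge
  · obtain ⟨hAsub, hAeq⟩ := hlow l hl0.le hlt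
    rw [measure_sdiff hAsub hA.nullMeasurableSet (hAeq ▸ ENNReal.ofReal_ne_top), hAeq]
  · have : {x | l < |f x|} \ A = ∅ := sdiff_eq_empty.2 fun x hx => hBA (hge.trans_lt hx)
    simp [this]

lemma zero_mem_L0S : (0 : ℝ → ℝ) ∈ L0S := ⟨measurable_zero, by simp⟩

lemma zero_mem_LpS {q : ℝ} (hq : 0 < q) : (0 : ℝ → ℝ) ∈ LpS q :=
  ⟨measurable_zero, by simp [Real.zero_rpow hq.ne']⟩

lemma measurable_of_mem_sumSet {q : ℝ} {f : ℝ → ℝ} (hf : f ∈ sumSet L0S (LpS q)) :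
    Measurable f := by
  obtain ⟨g, hg, h, hh, rfl⟩ := hf
  exact hg.1.add hh.1

end CSZ

open CSZ MeasureTheory ENNReal Set in
/-- from Lemma 3.6 of the paper.
Let `0 < q < ∞` and let `T` be a linear operator which is a contraction on the couple
`(L_0, L_q)`. Then for every `f ∈ L_0 + L_q` and every `t > 0`,
`∫_t^∞ μ(s,Tf)^q ds ≤ ∫_t^∞ μ(s,f)^q ds`, i.e. `|Tf|^q ≺≺_tl |f|^q`. -/
theorem statement11 (q : ℝ) (hq : 0 < q) (T : (ℝ → ℝ) → (ℝ → ℝ))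
    (hlin : IsLinearOn T (sumSet L0S (LpS q)))
    (hmaps : ∀ f ∈ sumSet L0S (LpS q), T f ∈ sumSet L0S (LpS q))
    (hT0 : BoundedWith T L0S L0Norm 1)
    (hTq : BoundedWith T (LpS q) (LpNorm q) 1) :
    ∀ f ∈ sumSet L0S (LpS q), ∀ t : ℝ, 0 < t →
      ∫⁻ s in Set.Ioi t, ENNReal.ofReal (mu (T f) s ^ q) ≤
        ∫⁻ s in Set.Ioi t, ENNReal.ofReal (mu f s ^ q) := by
  intro f hf t ht
  obtain ⟨g, h, hgm, hhm, hfgh, hg, hh⟩ := exists_decomposition hq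
    (measurable_of_mem_sumSet hf) (fun l hl => meas_lt_abs_lt_top hq hf hl) ht
  rcases eq_or_ne (∫⁻ s in Set.Ioi t, ENNReal.ofReal (mu f s ^ q)) ⊤ with htop | htop
  · exact htop ▸ le_top
  have hg0 : g ∈ L0S := ⟨hgm, hg.trans_lt ENNReal.ofReal_lt_top⟩
  have hhq : h ∈ LpS q := ⟨hhm, hh.trans_lt htop.lt_top⟩
  have hTf : T f = T g + T h := by
    rw [hfgh]
    exact hlin.1 g ⟨g, hg0, 0, zero_mem_LpS hq, (add_zero g).symm⟩
      h ⟨0, zero_mem_L0S, h, hhq, (zero_add h).symm⟩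
  obtain ⟨hTg0, hTg⟩ := hT0 g hg0
  obtain ⟨hThq, hTh⟩ := hTq h hhq
  have hTgt : m0 (Function.support (T g)) ≤ ENNReal.ofReal t := by
    rw [one_mul, L0Norm, L0Norm, ENNReal.toReal_le_toReal hTg0.2.ne hg0.2.ne] at hTg
    exact hTg.trans hg
  have hThle : ∫⁻ x, ENNReal.ofReal (|T h x| ^ q) ∂m0 ≤
      ∫⁻ x, ENNReal.ofReal (|h x| ^ q) ∂m0 := by
    have hq' : 0 < 1 / q := one_div_pos.2 hq
    rw [one_mul, LpNorm, LpNorm, ENNReal.toReal_le_toReal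
      (ENNReal.rpow_ne_top_of_nonneg hq'.le hThq.2.ne)
      (ENNReal.rpow_ne_top_of_nonneg hq'.le hhq.2.ne), ENNReal.rpow_le_rpow_iff hq'] at hTh
    exact hTh
  have hTmem := hmaps f hf
  rw [hTf] at hTmem ⊢
  exact (lintegral_tail_mu_add_le hq hThq.1 (measurable_of_mem_sumSet hTmem)
    (fun l hl => meas_lt_abs_lt_top hq hTmem hl) ht hTgt).trans (hThle.trans hh)
end
end

section
/- Let f, g ∈ L_1(0,∞) be positive decreasing step functions with g ≺_hd f (head majorization with ‖f‖_1 = ‖g‖_1). Then there exists a partition {I_k, J_k}_{k≥0} of (0,∞) such that: (i) for every k, I_k and J_k are disjoint intervals of finite length; (ii) (I_k ∪ J_k) ∩ (I_l ∪ J_l) = ∅ for k ≠ l; (iii) f and g are constant on each I_k and on each J_k; (iv) for every k, ∫_{I_k∪J_k} g = ∫_{I_k∪J_k} f and g·χ_{I_k∪J_k} ≺≺_hd f·χ_{I_k∪J_k}. -/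
open MeasureTheory ENNReal Set Filter

noncomputable section

namespace CSZ

/-- A (possibly degenerate) interval of finite length in `ℝ`. -/
def IsBoundedInterval (I : Set ℝ) : Prop :=
  I.OrdConnected ∧ ∃ a b : ℝ, I ⊆ Set.Icc a b

/-- A step function: a measurable function taking countably many values. -/
def IsStepFn (f : ℝ → ℝ) : Prop :=
  Measurable f ∧ (Set.range f).Countable

end CSZ

namespace CSZ

/-- The rearrangement of a function with two values `a ≥ a' ≥ 0` on sets of measure `p`, `q`. -/
lemma mu_two_step {S T : Set ℝ} (hS : MeasurableSet S) (hT : MeasurableSet T)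
    (hST : Disjoint S T) (hS0 : S ⊆ Ioi 0) (hT0 : T ⊆ Ioi 0) {p q a a' : ℝ}
    (hp : 0 ≤ p) (hq : 0 ≤ q) (hSp : volume S = ENNReal.ofReal p)
    (hTq : volume T = ENNReal.ofReal q) (ha' : 0 ≤ a') (haa' : a' ≤ a) {F : ℝ → ℝ}
    (hFS : ∀ x ∈ S, F x = a) (hFT : ∀ x ∈ T, F x = a') (hF : ∀ x, x ∉ S → x ∉ T → F x = 0)
    {s : ℝ} (hs : 0 < s) :
    mu F s = if s < p then a else if s < p + q then a' else 0 := by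
  have hmS : m0 S = ENNReal.ofReal p := by
    rw [m0, Measure.restrict_apply hS, inter_eq_left.2 hS0, hSp]
  have hmST : m0 (S ∪ T) = ENNReal.ofReal (p + q) := by
    rw [m0, Measure.restrict_apply (hS.union hT), inter_eq_left.2 (union_subset hS0 hT0),
      measure_union hST hT, hSp, hTq, ENNReal.ofReal_add hp hq]
  have habs : ∀ x, |F x| = F x := by
    intro x
    apply abs_of_nonneg
    by_cases h1 : x ∈ S
    · rw [hFS x h1]; linarith
    by_cases h2 : x ∈ T
    · rw [hFT x h2]; linarith
    rw [hF x h1 h2]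
  have hle : ∀ x, x ∉ S → F x ≤ a' := by
    intro x h1
    by_cases h2 : x ∈ T
    · rw [hFT x h2]
    · rw [hF x h1 h2]; exact ha'
  simp only [mu, habs]
  have key : ∀ c, 0 ≤ c → (∀ r, 0 ≤ r → r < c → ENNReal.ofReal s < m0 {x | r < F x}) →
      (∀ r, c ≤ r → m0 {x | r < F x} ≤ ENNReal.ofReal s) →
      sInf {r : ℝ | 0 ≤ r ∧ m0 {x | r < F x} ≤ ENNReal.ofReal s} = c := by
    intro c hc h1 h2
    have : {r : ℝ | 0 ≤ r ∧ m0 {x | r < F x} ≤ ENNReal.ofReal s} = Ici c := by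
      ext r
      simp only [mem_ofPred_eq, mem_Ici]
      constructor
      · rintro ⟨h3, h4⟩
        by_contra! h5
        exact (h1 r h3 h5).not_ge h4
      · intro h3
        exact ⟨hc.trans h3, h2 r h3⟩
    rw [this, csInf_Ici]
  split_ifs with h1 h2
  · refine key a (ha'.trans haa') ?_ ?_
    · intro r _ hr
      refine lt_of_lt_of_le ((ENNReal.ofReal_lt_ofReal_iff (hs.trans h1)).2 h1) ?_
      rw [← hmS]
      exact measure_mono fun x hx => by simpa [hFS x hx] using hr
    · intro r hr
      have : {x | r < F x} = ∅ := by
        ext x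
        simp only [mem_ofPred_eq, mem_empty_iff_false, iff_false, not_lt]
        by_cases h : x ∈ S
        · rw [hFS x h]; exact hr
        · exact (hle x h).trans (haa'.trans hr)
      simp [this]
  · refine key a' ha' ?_ ?_
    · intro r _ hr
      refine lt_of_lt_of_le ((ENNReal.ofReal_lt_ofReal_iff (hs.trans h2)).2 h2) ?_
      rw [← hmST]
      refine measure_mono ?_
      rintro x (hx | hx)
      · simpa [hFS x hx] using hr.trans_le haa'
      · simpa [hFT x hx] using hr
    · intro r hr
      calc m0 {x | r < F x} ≤ m0 S := measure_mono fun x hx => by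
            by_contra h
            exact ((hle x h).trans hr).not_gt hx
        _ ≤ _ := by rw [hmS]; exact ENNReal.ofReal_le_ofReal (not_lt.1 h1)
  · refine key 0 le_rfl (fun r h h' => absurd h h'.not_ge) ?_
    intro r hr
    calc m0 {x | r < F x} ≤ m0 (S ∪ T) := measure_mono fun x hx => by
          by_contra h
          simp only [mem_union, not_or] at h
          exact absurd hx (by simp [hF x h.1 h.2, hr])
      _ ≤ _ := by rw [hmST]; exact ENNReal.ofReal_le_ofReal (not_lt.1 h2)

lemma lintegral_two_step {p q t a a' : ℝ} (hp : 0 ≤ p) (hq : 0 ≤ q) (ht : 0 < t)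
    (ha : 0 ≤ a) (ha' : 0 ≤ a') :
    ∫⁻ s in Ioc (0 : ℝ) t, ENNReal.ofReal (if s < p then a else if s < p + q then a' else 0) =
      ENNReal.ofReal (a * min t p + a' * (min t (p + q) - min t p)) := by
  have hmin : 0 ≤ min t p := le_min ht.le hp
  have hmin' : 0 ≤ min t (p + q) - min t p :=
    sub_nonneg.2 (min_le_min le_rfl (by linarith))
  have h1 : ∀ s : ℝ, ENNReal.ofReal (if s < p then a else if s < p + q then a' else 0) =
      (Iio p).indicator (fun _ => ENNReal.ofReal a) s +
      (Ico p (p + q)).indicator (fun _ => ENNReal.ofReal a') s := by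
    intro s
    by_cases h1 : s < p
    · simp [h1, indicator, not_le.2 h1]
    · by_cases h2 : s < p + q
      · simp [h1, h2, indicator, not_lt.1 h1]
      · simp [h1, h2, indicator]
  have hv1 : volume (Iio p ∩ Ioc 0 t) = ENNReal.ofReal (min t p) := by
    refine le_antisymm ?_ ?_
    · calc _ ≤ volume (Ioc 0 (min t p)) := measure_mono fun x hx =>
            ⟨hx.2.1, le_min hx.2.2 (le_of_lt hx.1)⟩
        _ = _ := by simp
    · calc _ = volume (Ioo 0 (min t p)) := by simp
        _ ≤ _ := measure_mono fun x hx =>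
            show x ∈ Iio p ∩ Ioc 0 t from
              ⟨hx.2.trans_le (min_le_right _ _), hx.1, hx.2.le.trans (min_le_left _ _)⟩
  have hv2 : volume (Ico p (p + q) ∩ Ioc 0 t) =
      ENNReal.ofReal (min t (p + q) - min t p) := by
    refine le_antisymm ?_ ?_
    · calc _ ≤ volume (Icc (min t p) (min t (p + q))) := measure_mono fun x hx =>
            ⟨(min_le_right _ _).trans hx.1.1, le_min hx.2.2 (le_of_lt hx.1.2)⟩
        _ = _ := by simp
    · calc _ = volume (Ioo (min t p) (min t (p + q))) := by simp
        _ ≤ _ := measure_mono fun x hx => by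
          have h2 := hx.2.trans_le (min_le_left _ _)
          have h3 := hx.2.trans_le (min_le_right _ _)
          have h4 : p < x := by
            rcases min_lt_iff.1 hx.1 with h | h
            · exact absurd h h2.not_gt
            · exact h
          exact ⟨⟨h4.le, h3⟩, hmin.trans_lt hx.1, h2.le⟩
  simp_rw [h1]
  rw [lintegral_add_left (measurable_const.indicator measurableSet_Iio),
    lintegral_indicator_const measurableSet_Iio, lintegral_indicator_const measurableSet_Ico,
    Measure.restrict_apply measurableSet_Iio, Measure.restrict_apply measurableSet_Ico, hv1, hv2,
    ENNReal.ofReal_add (by positivity) (by positivity), ENNReal.ofReal_mul ha,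
    ENNReal.ofReal_mul ha']

/-- Head majorization between two functions with the same two sets of constancy. -/
lemma headMaj_two_step {S T : Set ℝ} (hS : MeasurableSet S) (hT : MeasurableSet T)
    (hST : Disjoint S T) (hS0 : S ⊆ Ioi 0) (hT0 : T ⊆ Ioi 0) {p q a a' b b' : ℝ}
    (hp : 0 ≤ p) (hq : 0 ≤ q) (hSp : volume S = ENNReal.ofReal p)
    (hTq : volume T = ENNReal.ofReal q) (ha' : 0 ≤ a') (haa' : a' ≤ a)
    (hb' : 0 ≤ b') (hbb' : b' ≤ b) (hab : p * b ≤ p * a)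
    (heq : p * a + q * a' = p * b + q * b') {f g : ℝ → ℝ}
    (hfS : ∀ x ∈ S, f x = a) (hfT : ∀ x ∈ T, f x = a')
    (hgS : ∀ x ∈ S, g x = b) (hgT : ∀ x ∈ T, g x = b') :
    HeadMaj ((S ∪ T).indicator g) ((S ∪ T).indicator f) := by
  intro t ht
  have hab' : q * a' ≤ q * b' := by linarith
  have hf : ∀ s ∈ Ioc 0 t, ENNReal.ofReal (mu ((S ∪ T).indicator f) s) =
      ENNReal.ofReal (if s < p then a else if s < p + q then a' else 0) :=
    fun s hs => congrArg _ <| mu_two_step hS hT hST hS0 hT0 hp hq hSp hTq ha' haa'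
      (fun x hx => by simp [hx, hfS x hx]) (fun x hx => by simp [hx, hfT x hx])
      (fun x h1 h2 => by simp [h1, h2]) hs.1
  have hg : ∀ s ∈ Ioc 0 t, ENNReal.ofReal (mu ((S ∪ T).indicator g) s) =
      ENNReal.ofReal (if s < p then b else if s < p + q then b' else 0) :=
    fun s hs => congrArg _ <| mu_two_step hS hT hST hS0 hT0 hp hq hSp hTq hb' hbb'
      (fun x hx => by simp [hx, hgS x hx]) (fun x hx => by simp [hx, hgT x hx])
      (fun x h1 h2 => by simp [h1, h2]) hs.1
  rw [setLIntegral_congr_fun measurableSet_Ioc hg,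
    setLIntegral_congr_fun measurableSet_Ioc hf,
    lintegral_two_step hp hq ht (hb'.trans hbb') hb',
    lintegral_two_step hp hq ht (ha'.trans haa') ha']
  apply ENNReal.ofReal_le_ofReal
  rcases le_total t p with h1 | h1
  · rw [min_eq_left h1, min_eq_left (by linarith)]
    have : b ≤ a := le_of_mul_le_mul_left hab (ht.trans_le h1)
    nlinarith
  · rw [min_eq_right h1]
    rcases le_total t (p + q) with h2 | h2
    · rw [min_eq_left h2]
      rcases hq.eq_or_lt with rfl | hq
      · have : t = p := by linarith
        subst this
        linarith
      · have : a' ≤ b' := le_of_mul_le_mul_left hab' hq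
        nlinarith
    · rw [min_eq_right h2]
      linarith

/-- A nonnegative decreasing function agrees almost everywhere with its rearrangement. -/
lemma lintegral_mu_of_antitoneOn {f : ℝ → ℝ} (hf0 : ∀ x, 0 ≤ f x)
    (hf : AntitoneOn f (Ioi 0)) (t : ℝ) :
    ∫⁻ s in Ioc (0 : ℝ) t, ENNReal.ofReal (mu f s) = ∫⁻ s in Ioc (0 : ℝ) t, ENNReal.ofReal (f s) := by
  have hcount : {x ∈ Ioi (0 : ℝ) | ¬ContinuousWithinAt f (Ioi 0) x}.Countable :=
    hf.countable_not_continuousWithinAt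
  apply lintegral_congr_ae
  have h1 : ∀ᵐ s ∂(volume.restrict (Ioc (0 : ℝ) t)),
      s ∉ {x ∈ Ioi (0 : ℝ) | ¬ContinuousWithinAt f (Ioi 0) x} :=
    ae_restrict_of_ae (hcount.ae_notMem volume)
  filter_upwards [h1, ae_restrict_mem measurableSet_Ioc] with s hs hst
  have hs0 : 0 < s := hst.1
  have hcont : ContinuousWithinAt f (Ioi 0) s := by
    by_contra h
    exact hs ⟨hs0, h⟩
  congr 1
  have hmem : f s ∈ {r : ℝ | 0 ≤ r ∧ m0 {x | r < |f x|} ≤ ENNReal.ofReal s} := by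
    refine ⟨hf0 s, ?_⟩
    rw [m0, Measure.restrict_apply' measurableSet_Ioi]
    calc _ ≤ volume (Ioc 0 s) := measure_mono fun x hx => by
          refine ⟨hx.2, ?_⟩
          by_contra! h
          have h2 : f s < |f x| := hx.1
          rw [abs_of_nonneg (hf0 x)] at h2
          exact (hf hs0 hx.2 h.le).not_gt h2
      _ = _ := by simp
  refine le_antisymm (csInf_le ⟨0, fun r hr => hr.1⟩ hmem) ?_
  refine le_csInf ⟨_, hmem⟩ ?_
  rintro r ⟨hr0, hr⟩
  have h3 : ∀ s' > s, f s' ≤ r := by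
    intro s' hs'
    by_contra! h
    refine hr.not_gt ?_
    rw [m0, Measure.restrict_apply' measurableSet_Ioi]
    calc ENNReal.ofReal s < ENNReal.ofReal s' :=
          (ENNReal.ofReal_lt_ofReal_iff (hs0.trans hs')).2 hs'
      _ = volume (Ioc 0 s') := by simp
      _ ≤ _ := measure_mono fun x hx => by
        refine ⟨?_, hx.1⟩
        change r < |f x|
        rw [abs_of_nonneg (hf0 x)]
        exact h.trans_le (hf hx.1 (hs0.trans hs') hx.2)
  have h4 : Tendsto f (nhdsWithin s (Ioi s)) (nhds (f s)) :=
    hcont.mono_left (nhdsWithin_mono _ fun x hx => hs0.trans hx)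
  exact le_of_tendsto h4 (by filter_upwards [self_mem_nhdsWithin] with s' hs' using h3 s' hs')

end CSZ
namespace CSZ

/-- The primitive of the positive part of `φ`. -/
def posMass (φ : ℝ → ℝ) (t : ℝ) : ℝ := ∫ x in (0 : ℝ)..t, max (φ x) 0

section PosMass

variable {φ : ℝ → ℝ}

lemma continuous_posMass (hφ : Integrable φ) : Continuous (posMass φ) :=
  intervalIntegral.continuous_primitive (fun _ _ => hφ.pos_part.intervalIntegrable) 0

lemma posMass_sub (hφ : Integrable φ) (x y : ℝ) :
    posMass φ y - posMass φ x = ∫ s in x..y, max (φ s) 0 :=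
  intervalIntegral.integral_interval_sub_left hφ.pos_part.intervalIntegrable
    hφ.pos_part.intervalIntegrable

lemma monotone_posMass (hφ : Integrable φ) : Monotone (posMass φ) := by
  intro x y hxy
  rw [← sub_nonneg, posMass_sub hφ]
  exact intervalIntegral.integral_nonneg hxy fun _ _ => le_max_right _ _

lemma posMass_zero : posMass φ 0 = 0 := by simp [posMass]

lemma posMass_sub_of_const (hφ : Integrable φ) {C : Set ℝ} (hC : C.OrdConnected) {c : ℝ}
    (h : ∀ x ∈ C, φ x = c) {x y : ℝ} (hx : x ∈ C) (hy : y ∈ C) :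
    posMass φ y - posMass φ x = max c 0 * (y - x) := by
  rw [posMass_sub hφ, intervalIntegral.integral_congr (g := fun _ => max c 0)]
  · simp [mul_comm]
  · intro s hs
    simp only [h s (hC.uIcc_subset hx hy hs)]

lemma tendsto_posMass (hφ : Integrable φ) :
    Tendsto (posMass φ) atTop (nhds (∫ x in Ioi 0, max (φ x) 0)) :=
  intervalIntegral_tendsto_integral_Ioi 0 hφ.pos_part.integrableOn tendsto_id

lemma posMass_le (hφ : Integrable φ) (t : ℝ) :
    posMass φ t ≤ ∫ x in Ioi 0, max (φ x) 0 :=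
  (monotone_posMass hφ).ge_of_tendsto (tendsto_posMass hφ) t

lemma posMass_sub_posMass_neg (hφ : Integrable φ) (t : ℝ) :
    posMass φ t - posMass (-φ) t = ∫ x in (0 : ℝ)..t, φ x := by
  rw [posMass, posMass, ← intervalIntegral.integral_sub hφ.pos_part.intervalIntegrable
    hφ.neg.pos_part.intervalIntegrable]
  congr 1
  ext x
  rcases le_total 0 (φ x) with h | h <;> simp [h]

/-- `posMass φ` is strictly increasing at interior points of a set where `φ` is a positive
constant. -/
lemma eq_of_posMass_eq (hφ : Integrable φ) {C : Set ℝ} (hC : C.OrdConnected) {c : ℝ} (hc : 0 < c)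
    (h : ∀ x ∈ C, φ x = c) {x y : ℝ} (hx : x ∈ interior C) (hxy : posMass φ x = posMass φ y) :
    x = y := by
  obtain ⟨l, u, hlu, hsub⟩ := mem_nhds_iff_exists_Ioo_subset.1 (mem_interior_iff_mem_nhds.1 hx)
  have hmono := monotone_posMass hφ
  have hxC := hsub hlu
  rcases lt_trichotomy x y with hlt | heq | hlt
  · obtain ⟨z, hz1, hz2⟩ := exists_between (lt_min hlt hlu.2)
    have h1 := posMass_sub_of_const hφ hC h hxC
      (hsub ⟨hlu.1.trans hz1, hz2.trans_le (min_le_right _ _)⟩)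
    have h2 := hmono (hz2.trans_le (min_le_left _ _)).le
    rw [max_eq_left hc.le] at h1
    nlinarith [mul_pos hc (sub_pos.2 hz1)]
  · exact heq
  · obtain ⟨z, hz1, hz2⟩ := exists_between (max_lt hlt hlu.1)
    have h1 := posMass_sub_of_const hφ hC h
      (hsub ⟨(le_max_right _ _).trans_lt hz1, hz2.trans hlu.2⟩) hxC
    have h2 := hmono ((le_max_left _ _).trans_lt hz1).le
    rw [max_eq_left hc.le] at h1
    nlinarith [mul_pos hc (sub_pos.2 hz2)]

end PosMass

lemma countable_diff_interior {C : Set ℝ} (hC : C.OrdConnected) : (C \ interior C).Countable := by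
  have h1 : {x | IsLeast C x}.Subsingleton := fun x hx y hy => hx.unique hy
  have h2 : {x | IsGreatest C x}.Subsingleton := fun x hx y hy => hx.unique hy
  refine (h1.countable.union h2.countable).mono ?_
  rintro x ⟨hx, hxi⟩
  by_contra hcon
  simp only [mem_union, mem_ofPred_eq, not_or, IsLeast, IsGreatest, hx, true_and, lowerBounds,
    upperBounds, not_forall, not_le] at hcon
  obtain ⟨⟨y, hy, hyx⟩, z, hz, hxz⟩ := hcon
  exact hxi (mem_interior_iff_mem_nhds.2
    (mem_of_superset (Icc_mem_nhds hyx hxz) (hC.out hy hz)))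

/-- A countable family of intervals partitioning the half line, with `φ` equal to the constant
`α i` on the `i`-th one. -/
structure IsCellDecomposition {ι : Type*} (φ : ℝ → ℝ) (C : ι → Set ℝ) (α : ι → ℝ) : Prop where
  ordConnected : ∀ i, (C i).OrdConnected
  index_unique : ∀ i j x, x ∈ C i → x ∈ C j → i = j
  exists_mem : ∀ x, 0 < x → ∃ i, x ∈ C i
  pos : ∀ i, ∀ x ∈ C i, 0 < x
  eq : ∀ i, ∀ x ∈ C i, φ x = α i

/-- The points of the cell `i`, carrying positive mass, which are matched by monotone transport of
the positive part of `φ` to the negative part with a point of the cell `j`. -/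
def matched {ι : Type*} (φ : ℝ → ℝ) (C : ι → Set ℝ) (α : ι → ℝ) (i j : ι) : Set ℝ :=
  {x | x ∈ interior (C i) ∧ 0 < α i ∧ α j < 0 ∧
    ∃ y ∈ interior (C j), posMass φ x = posMass (-φ) y}

namespace IsCellDecomposition

variable {ι : Type*} {φ : ℝ → ℝ} {C : ι → Set ℝ} {α : ι → ℝ}

lemma neg (h : IsCellDecomposition φ C α) : IsCellDecomposition (-φ) C (-α) :=
  ⟨h.ordConnected, h.index_unique, h.exists_mem, h.pos, fun i x hx => by simp [h.eq i x hx]⟩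

lemma index_eq_of_matched (h : IsCellDecomposition φ C α) (hφ : Integrable φ) {i j i' j' : ι}
    {x : ℝ} (hx : x ∈ matched φ C α i j) (hx' : x ∈ matched φ C α i' j') : i = i' ∧ j = j' := by
  obtain ⟨hxi, -, hj, y, hy, hxy⟩ := hx
  obtain ⟨hxi', -, -, y', hy', hxy'⟩ := hx'
  have := eq_of_posMass_eq hφ.neg (h.ordConnected j) (neg_pos.2 hj) (h.neg.eq j) hy
    (hxy.symm.trans hxy')
  subst this
  exact ⟨h.index_unique _ _ x (interior_subset hxi) (interior_subset hxi'),
    h.index_unique _ _ y (interior_subset hy) (interior_subset hy')⟩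

lemma ordConnected_matched (h : IsCellDecomposition φ C α) (hφ : Integrable φ) (i j : ι) :
    (matched φ C α i j).OrdConnected := by
  have hord : ∀ k, (interior (C k)).OrdConnected := fun k => (h.ordConnected k).interior
  refine ⟨?_⟩
  rintro x ⟨hx, hi, hj, y, hy, hxy⟩ x' ⟨hx', -, -, y', hy', hxy'⟩ z hz
  refine ⟨(hord i).out hx hx' hz, hi, hj, ?_⟩
  have himg : (posMass (-φ) '' interior (C j)).OrdConnected :=
    ((hord j).isPreconnected.image _ (continuous_posMass hφ.neg).continuousOn).ordConnected
  obtain ⟨w, hw, hwz⟩ := himg.out (mem_image_of_mem _ hy) (mem_image_of_mem _ hy')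
    ⟨hxy ▸ monotone_posMass hφ hz.1, hxy' ▸ monotone_posMass hφ hz.2⟩
  exact ⟨w, hw, hwz.symm⟩

lemma image_matched (i j : ι) :
    posMass φ '' matched φ C α i j = posMass (-φ) '' matched (-φ) C (-α) j i := by
  ext s
  constructor
  · rintro ⟨x, ⟨hx, hi, hj, y, hy, hxy⟩, rfl⟩
    exact ⟨y, ⟨hy, by simpa using hj, by simpa using hi, x, hx, by simpa using hxy.symm⟩, hxy.symm⟩
  · rintro ⟨y, ⟨hy, hj, hi, x, hx, hxy⟩, rfl⟩
    rw [neg_neg] at hxy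
    exact ⟨x, ⟨hx, by simpa using hi, by simpa using hj, y, hy, hxy.symm⟩, hxy.symm⟩

lemma volume_image_matched (h : IsCellDecomposition φ C α) (hφ : Integrable φ) (i j : ι) :
    volume (posMass φ '' matched φ C α i j) =
      ENNReal.ofReal (α i) * volume (matched φ C α i j) := by
  rcases (matched φ C α i j).eq_empty_or_nonempty with he | ⟨x, hx⟩
  · simp [he]
  have hi := hx.2.1
  have himg : posMass φ '' matched φ C α i j =
      (fun s => (posMass φ x - α i * x) + s) '' ((fun s => α i * s) '' matched φ C α i j) := by
    rw [image_image]
    refine image_congr fun s hs => ?_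
    have := posMass_sub_of_const hφ (h.ordConnected i) (h.eq i) (interior_subset hx.1)
      (interior_subset hs.1)
    rw [max_eq_left hi.le] at this
    linarith
  rw [himg, image_add_left, measure_preimage_add]
  have := Measure.addHaar_smul volume (α i) (matched φ C α i j)
  simp only [Module.finrank_self, pow_one, abs_of_pos hi] at this
  exact this

/-- The two matched pieces carry the same mass. -/
lemma mul_volume_matched (h : IsCellDecomposition φ C α) (hφ : Integrable φ) (i j : ι) :
    ENNReal.ofReal (α i) * volume (matched φ C α i j) =
      ENNReal.ofReal (-α j) * volume (matched (-φ) C (-α) j i) := by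
  rw [← h.volume_image_matched hφ, image_matched, h.neg.volume_image_matched hφ.neg, Pi.neg_apply]

/-- All but countably many points carrying positive mass are matched. -/
lemma countable_unmatched [Countable ι] (h : IsCellDecomposition φ C α) (hφ : Integrable φ)
    (hlim : ∫ x in Ioi 0, max (φ x) 0 = ∫ x in Ioi 0, max ((-φ) x) 0) :
    {x | 0 < x ∧ 0 < φ x ∧ ∀ i j, x ∉ matched φ C α i j}.Countable := by
  set K : Set ℝ := (⋃ j, posMass (-φ) '' (C j \ interior (C j))) ∪
    ⋃ j, ⋃ (_ : 0 ≤ α j), posMass (-φ) '' C j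
  have hKc : K.Countable := by
    refine (countable_iUnion fun j => (countable_diff_interior (h.ordConnected j)).image _).union
      (countable_iUnion fun j => countable_iUnion fun hj => Set.Subsingleton.countable ?_)
    rintro _ ⟨x, hx, rfl⟩ _ ⟨y, hy, rfl⟩
    have := posMass_sub_of_const hφ.neg (h.ordConnected j) (h.neg.eq j) hx hy
    rw [max_eq_right (by simpa using hj)] at this
    linarith
  have hcov : {x | 0 < x ∧ 0 < φ x ∧ ∀ i j, x ∉ matched φ C α i j} ⊆
      (⋃ i, C i \ interior (C i)) ∪
        ⋃ i, ⋃ (_ : 0 < α i), {x | x ∈ interior (C i) ∧ posMass φ x ∈ K} := by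
    rintro x ⟨hx0, hx, hxm⟩
    obtain ⟨i, hi⟩ := h.exists_mem x hx0
    rw [h.eq i x hi] at hx
    by_cases hxi : x ∈ interior (C i)
    swap
    · exact Or.inl (mem_iUnion.2 ⟨i, hi, hxi⟩)
    refine Or.inr (mem_iUnion₂.2 ⟨i, hx, hxi, ?_⟩)
    have hlt : posMass φ x < posMass φ (x + 1) :=
      lt_of_le_of_ne (monotone_posMass hφ (by linarith)) fun heq => by
        have := eq_of_posMass_eq hφ (h.ordConnected i) hx (h.eq i) hxi heq
        linarith
    have hgt : posMass φ 0 < posMass φ x :=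
      lt_of_le_of_ne (monotone_posMass hφ hx0.le) fun heq => by
        have := eq_of_posMass_eq hφ (h.ordConnected i) hx (h.eq i) hxi heq.symm
        linarith
    have hlt' := hlt.trans_le (posMass_le hφ (x + 1))
    rw [hlim] at hlt'
    obtain ⟨b, hb, hb0⟩ := (((tendsto_posMass hφ.neg).eventually (lt_mem_nhds hlt')).and
      (eventually_ge_atTop 0)).exists
    obtain ⟨y, hy, hxy⟩ := intermediate_value_Icc hb0 (continuous_posMass hφ.neg).continuousOn
      ⟨by rw [posMass_zero] at hgt ⊢; exact hgt.le, hb.le⟩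
    have hy0 : 0 < y := by
      refine lt_of_le_of_ne hy.1 fun h0 => ?_
      rw [← h0, posMass_zero] at hxy
      rw [posMass_zero] at hgt
      linarith
    obtain ⟨j, hj⟩ := h.exists_mem y hy0
    rw [← hxy]
    rcases le_or_gt 0 (α j) with hα | hα
    · exact Or.inr (mem_iUnion₂.2 ⟨j, hα, mem_image_of_mem _ hj⟩)
    · refine Or.inl (mem_iUnion.2 ⟨j, mem_image_of_mem _ ⟨hj, fun hyi => ?_⟩⟩)
      exact hxm i j ⟨hxi, hx, hα, y, hyi, hxy.symm⟩
  refine Countable.mono hcov ((countable_iUnion fun i =>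
    countable_diff_interior (h.ordConnected i)).union
    (countable_iUnion fun i => countable_iUnion fun hi => ?_))
  refine MapsTo.countable_of_injOn (f := posMass φ) (t := K) (fun x hx => hx.2) ?_ hKc
  intro x hx y _ hxy
  exact eq_of_posMass_eq hφ (h.ordConnected i) hi (h.eq i) hx.1 hxy

end IsCellDecomposition

end CSZ
namespace CSZ

/-- The pair of intervals `I`, `J` satisfies the requirements of the partition lemma. -/
structure IsMatchedPair (f g : ℝ → ℝ) (I J : Set ℝ) : Prop where
  left : IsBoundedInterval I
  right : IsBoundedInterval J
  disjoint : Disjoint I J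
  f_left : ∃ c : ℝ, ∀ x ∈ I, f x = c
  f_right : ∃ c : ℝ, ∀ x ∈ J, f x = c
  g_left : ∃ c : ℝ, ∀ x ∈ I, g x = c
  g_right : ∃ c : ℝ, ∀ x ∈ J, g x = c
  lintegral_eq : ∫⁻ x in I ∪ J, ENNReal.ofReal (g x) ∂m0 = ∫⁻ x in I ∪ J, ENNReal.ofReal (f x) ∂m0
  headMaj : HeadMaj ((I ∪ J).indicator g) ((I ∪ J).indicator f)

lemma isBoundedInterval_empty : IsBoundedInterval ∅ := ⟨ordConnected_empty, 0, 0, by simp⟩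

lemma isMatchedPair_of_eq {f g : ℝ → ℝ} {I : Set ℝ} (hI : IsBoundedInterval I) {c : ℝ}
    (hf : ∀ x ∈ I, f x = c) (hg : ∀ x ∈ I, g x = c) : IsMatchedPair f g I ∅ where
  left := hI
  right := isBoundedInterval_empty
  disjoint := disjoint_empty _
  f_left := ⟨c, hf⟩
  f_right := ⟨0, by simp⟩
  g_left := ⟨c, hg⟩
  g_right := ⟨0, by simp⟩
  lintegral_eq := by
    rw [union_empty]
    exact setLIntegral_congr_fun hI.1.measurableSet fun x hx => by rw [hf x hx, hg x hx]
  headMaj := by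
    have : (I ∪ ∅).indicator g = (I ∪ ∅).indicator f :=
      indicator_congr fun x hx => by
        rw [union_empty] at hx
        rw [hf x hx, hg x hx]
    rw [this]
    exact fun t _ => le_rfl

lemma isMatchedPair_empty (f g : ℝ → ℝ) : IsMatchedPair f g ∅ ∅ :=
  isMatchedPair_of_eq (c := 0) isBoundedInterval_empty (by simp) (by simp)

lemma isMatchedPair_of_measure_eq {f g : ℝ → ℝ} {I J : Set ℝ} (hI : IsBoundedInterval I)
    (hJ : IsBoundedInterval J) (hIJ : Disjoint I J) (hI0 : I ⊆ Ioi 0) (hJ0 : J ⊆ Ioi 0)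
    {a a' b b' : ℝ} (ha' : 0 ≤ a') (haa' : a' ≤ a) (hb' : 0 ≤ b') (hbb' : b' ≤ b)
    (hab : (volume I).toReal * b ≤ (volume I).toReal * a)
    (heq : (volume I).toReal * a + (volume J).toReal * a' =
      (volume I).toReal * b + (volume J).toReal * b')
    (hfI : ∀ x ∈ I, f x = a) (hfJ : ∀ x ∈ J, f x = a')
    (hgI : ∀ x ∈ I, g x = b) (hgJ : ∀ x ∈ J, g x = b') : IsMatchedPair f g I J := by
  have hfin : ∀ {S : Set ℝ}, IsBoundedInterval S → volume S = ENNReal.ofReal (volume S).toReal := by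
    rintro S ⟨-, l, u, hS⟩
    refine (ENNReal.ofReal_toReal ?_).symm
    exact ((measure_mono hS).trans_lt (by simp)).ne
  have hconst : ∀ {h : ℝ → ℝ} {c c' : ℝ}, 0 ≤ c → 0 ≤ c' → (∀ x ∈ I, h x = c) →
      (∀ x ∈ J, h x = c') → ∫⁻ x in I ∪ J, ENNReal.ofReal (h x) ∂m0 =
        ENNReal.ofReal ((volume I).toReal * c + (volume J).toReal * c') := by
    intro h c c' hc hc' hcI hcJ
    rw [m0, Measure.restrict_restrict_of_subset (union_subset hI0 hJ0),
      lintegral_union hJ.1.measurableSet hIJ,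
      setLIntegral_congr_fun hI.1.measurableSet (g := fun _ => ENNReal.ofReal c)
        (fun x hx => by simp only [hcI x hx]),
      setLIntegral_congr_fun hJ.1.measurableSet (g := fun _ => ENNReal.ofReal c')
        (fun x hx => by simp only [hcJ x hx]),
      setLIntegral_const, setLIntegral_const, ENNReal.ofReal_add (by positivity) (by positivity),
      ENNReal.ofReal_mul (by positivity), ENNReal.ofReal_mul (by positivity), ← hfin hI, ← hfin hJ,
      mul_comm, mul_comm (volume J)]
  refine ⟨hI, hJ, hIJ, ⟨a, hfI⟩, ⟨a', hfJ⟩, ⟨b, hgI⟩, ⟨b', hgJ⟩, ?_, ?_⟩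
  · rw [hconst (hb'.trans hbb') hb' hgI hgJ, hconst (ha'.trans haa') ha' hfI hfJ, heq]
  · exact headMaj_two_step hI.1.measurableSet hJ.1.measurableSet hIJ hI0 hJ0
      ENNReal.toReal_nonneg ENNReal.toReal_nonneg (hfin hI) (hfin hJ) ha' haa' hb' hbb' hab heq
      hfI hfJ hgI hgJ

lemma isMatchedPair_singleton {f g : ℝ → ℝ} (hf0 : ∀ x, 0 ≤ f x) (hg0 : ∀ x, 0 ≤ g x) {x : ℝ}
    (hx : 0 < x) : IsMatchedPair f g {x} ∅ :=
  isMatchedPair_of_measure_eq (a := f x) (a' := 0) (b := g x) (b' := 0)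
    ⟨ordConnected_singleton, x, x, by simp⟩ isBoundedInterval_empty (disjoint_empty _)
    (by simpa using hx) (by simp) le_rfl (hf0 x) le_rfl (hg0 x) (by simp) (by simp)
    (by simp) (by simp) (by simp) (by simp)

/-- A countable family of pairwise disjoint pairs of sets can be indexed by `ℕ`, adding empty
pairs if necessary. -/
lemma exists_nat_indexing {κ : Type*} [Countable κ] {P : Set ℝ → Set ℝ → Prop} (h0 : P ∅ ∅)
    {A B : κ → Set ℝ} (hP : ∀ k, P (A k) (B k))
    (hAB : ∀ k l x, x ∈ A k ∪ B k → x ∈ A l ∪ B l → k = l) :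
    ∃ I J : ℕ → Set ℝ, (∀ k, P (I k) (J k)) ∧
      (∀ k l, k ≠ l → Disjoint (I k ∪ J k) (I l ∪ J l)) ∧
      (⋃ k, I k ∪ J k) = ⋃ k, A k ∪ B k := by
  obtain ⟨e, he⟩ := exists_injective_nat κ
  have hval : ∀ n, (∃ k, e k = n ∧ Function.extend e A (fun _ => ∅) n = A k ∧
      Function.extend e B (fun _ => ∅) n = B k) ∨
      (Function.extend e A (fun _ => ∅) n = ∅ ∧ Function.extend e B (fun _ => ∅) n = ∅) := by
    intro n
    by_cases hn : ∃ k, e k = n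
    · obtain ⟨k, rfl⟩ := hn
      exact Or.inl ⟨k, rfl, he.extend_apply _ _ _, he.extend_apply _ _ _⟩
    · exact Or.inr ⟨Function.extend_apply' _ _ _ hn, Function.extend_apply' _ _ _ hn⟩
  refine ⟨Function.extend e A fun _ => ∅, Function.extend e B fun _ => ∅, fun n => ?_,
    fun n m hnm => ?_, ?_⟩
  · rcases hval n with ⟨k, -, h1, h2⟩ | ⟨h1, h2⟩
    · rw [h1, h2]; exact hP k
    · rw [h1, h2]; exact h0
  · rcases hval n with ⟨k, hk, h1, h2⟩ | ⟨h1, h2⟩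
    · rcases hval m with ⟨l, hl, h3, h4⟩ | ⟨h3, h4⟩
      · rw [h1, h2, h3, h4, Set.disjoint_left]
        intro x hx hx'
        exact hnm (by rw [← hk, ← hl, hAB k l x hx hx'])
      · simp [h3, h4]
    · simp [h1, h2]
  · ext x
    simp only [mem_iUnion]
    constructor
    · rintro ⟨n, hn⟩
      rcases hval n with ⟨k, -, h1, h2⟩ | ⟨h1, h2⟩
      · rw [h1, h2] at hn; exact ⟨k, hn⟩
      · simp [h1, h2] at hn
    · rintro ⟨k, hk⟩
      exact ⟨e k, by rwa [he.extend_apply, he.extend_apply]⟩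

/-- The cell on which `f` and `g` take the given values, cut to the unit interval `(n, n + 1]`. -/
def valueCell (f g : ℝ → ℝ) (i : range f × range g × ℕ) : Set ℝ :=
  {x | 0 < x ∧ f x = i.1 ∧ g x = i.2.1 ∧ x ∈ Ioc (i.2.2 : ℝ) (i.2.2 + 1)}

lemma isCellDecomposition_valueCell {f g : ℝ → ℝ} (hf : AntitoneOn f (Ioi 0))
    (hg : AntitoneOn g (Ioi 0)) :
    IsCellDecomposition ((Ioi 0).indicator (f - g)) (valueCell f g)
      (fun i => (i.1 : ℝ) - i.2.1) where
  ordConnected i := by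
    refine ⟨?_⟩
    rintro x ⟨hx0, hxf, hxg, hxn⟩ y ⟨hy0, hyf, hyg, hyn⟩ z ⟨hxz, hzy⟩
    have hz0 : 0 < z := hx0.trans_le hxz
    refine ⟨hz0, le_antisymm ?_ ?_, le_antisymm ?_ ?_, hxn.1.trans_le hxz, hzy.trans hyn.2⟩
    · exact hxf ▸ hf hx0 hz0 hxz
    · exact hyf ▸ hf hz0 hy0 hzy
    · exact hxg ▸ hg hx0 hz0 hxz
    · exact hyg ▸ hg hz0 hy0 hzy
  index_unique := by
    rintro ⟨⟨a, ha⟩, ⟨b, hb⟩, n⟩ ⟨⟨a', ha'⟩, ⟨b', hb'⟩, m⟩ x ⟨-, h1, h2, h3, h4⟩ ⟨-, h5, h6, h7, h8⟩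
    simp only at h1 h2 h3 h4 h5 h6 h7 h8
    have h9 : n < m + 1 := by exact_mod_cast h3.trans_le h8
    have h10 : m < n + 1 := by exact_mod_cast h7.trans_le h4
    have : n = m := by omega
    subst h1 h2 h5 h6 this
    rfl
  exists_mem x hx := by
    obtain ⟨n, hn⟩ : ∃ n : ℕ, ⌈x⌉₊ = n + 1 := Nat.exists_eq_add_one.2 (Nat.ceil_pos.2 hx)
    have h1 := Nat.le_ceil x
    have h2 := Nat.ceil_lt_add_one hx.le
    rw [hn] at h1 h2
    push_cast at h1 h2
    exact ⟨⟨⟨f x, mem_range_self x⟩, ⟨g x, mem_range_self x⟩, n⟩, hx, rfl, rfl,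
      by simpa using h2, h1⟩
  pos i x hx := hx.1
  eq i x hx := by
    rw [indicator_of_mem (mem_Ioi.2 hx.1), Pi.sub_apply, hx.2.1, hx.2.2.1]

lemma isBoundedInterval_of_subset_valueCell {f g : ℝ → ℝ} {i : range f × range g × ℕ} {S : Set ℝ}
    (hS : S.OrdConnected) (h : S ⊆ valueCell f g i) : IsBoundedInterval S :=
  ⟨hS, _, _, fun _ hx => Ioc_subset_Icc_self (h hx).2.2.2⟩

lemma matched_subset {ι : Type*} (φ : ℝ → ℝ) (C : ι → Set ℝ) (α : ι → ℝ) (i j : ι) :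
    matched φ C α i j ⊆ C i := fun _ hx => interior_subset hx.1

lemma isMatchedPair_matched {f g : ℝ → ℝ} (hf0 : ∀ x, 0 ≤ f x) (hg0 : ∀ x, 0 ≤ g x)
    (hf : AntitoneOn f (Ioi 0)) (hg : AntitoneOn g (Ioi 0)) {φ : ℝ → ℝ}
    {α : range f × range g × ℕ → ℝ} (hα : ∀ i, α i = i.1 - i.2.1)
    (h : IsCellDecomposition φ (valueCell f g) α) (hφ : Integrable φ)
    (hle : ∀ t, 0 ≤ t → posMass (-φ) t ≤ posMass φ t) (i j : range f × range g × ℕ) :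
    IsMatchedPair f g (matched φ (valueCell f g) α i j)
      (matched (-φ) (valueCell f g) (-α) j i) := by
  rcases (matched φ (valueCell f g) α i j).eq_empty_or_nonempty with he | ⟨x, hx⟩
  · have he' : matched (-φ) (valueCell f g) (-α) j i = ∅ := by
      rw [← image_eq_empty (f := posMass (-φ)), ← IsCellDecomposition.image_matched, he, image_empty]
    rw [he, he']
    exact isMatchedPair_empty f g
  have hIi := matched_subset φ (valueCell f g) α i j
  have hJj := matched_subset (-φ) (valueCell f g) (-α) j i
  have hIb := isBoundedInterval_of_subset_valueCell (h.ordConnected_matched hφ i j) hIi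
  have hJb := isBoundedInterval_of_subset_valueCell (h.neg.ordConnected_matched hφ.neg j i) hJj
  have hvol := congrArg ENNReal.toReal (h.mul_volume_matched hφ i j)
  obtain ⟨hxi, hi, hj, y, hy, hxy⟩ := hx
  have hxi' := interior_subset hxi
  have hyj := interior_subset hy
  have hij : ∀ z, z ∈ valueCell f g i → z ∉ valueCell f g j := fun z hzi hzj => by
    have := h.index_unique i j z hzi hzj
    subst this
    exact hi.not_gt hj
  have hlt : x < y := by
    by_contra! hyx
    have := eq_of_posMass_eq hφ (h.ordConnected i) hi (h.eq i) hxi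
      (le_antisymm (hxy ▸ hle y hyj.1.le) (monotone_posMass hφ hyx))
    exact hij x hxi' (this ▸ hyj)
  have haa : (j.1 : ℝ) ≤ i.1 := by
    rw [← hxi'.2.1, ← hyj.2.1]; exact hf hxi'.1 hyj.1 hlt.le
  have hbb : (j.2.1 : ℝ) ≤ i.2.1 := by
    rw [← hxi'.2.2.1, ← hyj.2.2.1]; exact hg hxi'.1 hyj.1 hlt.le
  rw [ENNReal.toReal_mul, ENNReal.toReal_mul, ENNReal.toReal_ofReal hi.le,
    ENNReal.toReal_ofReal (neg_pos.2 hj).le, hα, hα] at hvol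
  rw [hα] at hi
  refine isMatchedPair_of_measure_eq (a := i.1) (a' := j.1) (b := i.2.1) (b' := j.2.1) hIb hJb
    (disjoint_left.2 fun z hz hz' => hij z (hIi hz) (hJj hz')) (fun z hz => (hIi hz).1)
    (fun z hz => (hJj hz).1) (hyj.2.1 ▸ hf0 y) haa (hyj.2.2.1 ▸ hg0 y) hbb
    (mul_le_mul_of_nonneg_left (by linarith) ENNReal.toReal_nonneg) (by linarith)
    (fun z hz => (hIi hz).2.1) (fun z hz => (hJj hz).2.1)
    (fun z hz => (hIi hz).2.2.1) (fun z hz => (hJj hz).2.2.1)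

lemma integrableOn_of_mem_LpS_one {f : ℝ → ℝ} (hf : f ∈ LpS 1) : IntegrableOn f (Ioi 0) := by
  refine ⟨hf.1.aestronglyMeasurable, ?_⟩
  have h2 := hf.2
  simp only [Real.rpow_one] at h2
  simpa only [HasFiniteIntegral, ← ofReal_norm, Real.norm_eq_abs, m0] using h2

end CSZ

open CSZ MeasureTheory ENNReal Set in
/-- first partition lemma, Lemma 4.1 of the paper.
Let `f, g ∈ L_1(0,∞)` be positive decreasing step functions with `g ≺_hd f`
(head majorization together with `‖g‖_1 = ‖f‖_1`). Then there is a partition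
`{I_k, J_k}_{k ≥ 0}` of `(0,∞)` into bounded intervals such that the unions `I_k ∪ J_k`
are pairwise disjoint, `f` and `g` are constant on each `I_k` and each `J_k`, and on each
`I_k ∪ J_k` the restrictions satisfy `g ≺_hd f`. -/
theorem statement12 (f g : ℝ → ℝ)
    (hf : f ∈ LpS 1) (hg : g ∈ LpS 1)
    (hf0 : ∀ x, 0 ≤ f x) (hg0 : ∀ x, 0 ≤ g x)
    (hfdec : AntitoneOn f (Set.Ioi 0)) (hgdec : AntitoneOn g (Set.Ioi 0))
    (hfstep : IsStepFn f) (hgstep : IsStepFn g)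
    (hmaj : HeadMaj g f)
    (heqnorm : ∫⁻ x, ENNReal.ofReal (g x) ∂m0 = ∫⁻ x, ENNReal.ofReal (f x) ∂m0) :
    ∃ I J : ℕ → Set ℝ,
      (∀ k, IsBoundedInterval (I k) ∧ IsBoundedInterval (J k) ∧ Disjoint (I k) (J k)) ∧
      (∀ k l, k ≠ l → Disjoint (I k ∪ J k) (I l ∪ J l)) ∧
      (⋃ k, I k ∪ J k) = Set.Ioi (0:ℝ) ∧
      (∀ k, (∃ c : ℝ, ∀ x ∈ I k, f x = c) ∧ (∃ c : ℝ, ∀ x ∈ J k, f x = c) ∧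
            (∃ c : ℝ, ∀ x ∈ I k, g x = c) ∧ (∃ c : ℝ, ∀ x ∈ J k, g x = c)) ∧
      (∀ k, (∫⁻ x in I k ∪ J k, ENNReal.ofReal (g x) ∂m0 =
               ∫⁻ x in I k ∪ J k, ENNReal.ofReal (f x) ∂m0) ∧
            HeadMaj ((I k ∪ J k).indicator g) ((I k ∪ J k).indicator f)) := by
  have hfi := integrableOn_of_mem_LpS_one hf
  have hgi := integrableOn_of_mem_LpS_one hg
  have hfpos : ∀ S : Set ℝ, 0 ≤ᵐ[volume.restrict S] f := fun S => .of_forall hf0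
  have hgpos : ∀ S : Set ℝ, 0 ≤ᵐ[volume.restrict S] g := fun S => .of_forall hg0
  set φ : ℝ → ℝ := (Ioi 0).indicator (f - g) with hφdef
  have hφ : Integrable φ := (hfi.sub hgi).integrable_indicator measurableSet_Ioi
  have hcell := isCellDecomposition_valueCell hfdec hgdec
  rw [← hφdef] at hcell
  set α : range f × range g × ℕ → ℝ := fun i => (i.1 : ℝ) - i.2.1
  have hle : ∀ t, 0 ≤ t → posMass (-φ) t ≤ posMass φ t := by
    intro t ht
    rw [← sub_nonneg, posMass_sub_posMass_neg hφ, intervalIntegral.integral_of_le ht,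
      setIntegral_congr_fun measurableSet_Ioc (g := fun x => f x - g x)
        (fun x hx => by simp [hφdef, hx.1]),
      integral_sub (hfi.mono_set Ioc_subset_Ioi_self) (hgi.mono_set Ioc_subset_Ioi_self),
      sub_nonneg, integral_eq_lintegral_of_nonneg_ae (hgpos _) hg.1.aestronglyMeasurable,
      integral_eq_lintegral_of_nonneg_ae (hfpos _) hf.1.aestronglyMeasurable]
    rcases ht.eq_or_lt with rfl | ht
    · simp
    have := hmaj t ht
    rw [lintegral_mu_of_antitoneOn hf0 hfdec, lintegral_mu_of_antitoneOn hg0 hgdec] at this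
    refine ENNReal.toReal_mono ?_ this
    exact ((hasFiniteIntegral_iff_ofReal (hfpos _)).1
      (hfi.mono_set Ioc_subset_Ioi_self).hasFiniteIntegral).ne
  have hlim : ∫ x in Ioi 0, max (φ x) 0 = ∫ x in Ioi 0, max ((-φ) x) 0 := by
    have h0 : ∫ x in Ioi 0, φ x = 0 := by
      rw [setIntegral_congr_fun measurableSet_Ioi (g := fun x => f x - g x)
        (fun x hx => by simp [hφdef, mem_Ioi.1 hx]), integral_sub hfi hgi, sub_eq_zero,
        integral_eq_lintegral_of_nonneg_ae (hgpos _) hg.1.aestronglyMeasurable,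
        integral_eq_lintegral_of_nonneg_ae (hfpos _) hf.1.aestronglyMeasurable]
      exact congrArg ENNReal.toReal heqnorm.symm
    have h1 : Tendsto (fun t => posMass φ t - posMass (-φ) t) atTop
        (nhds (∫ x in Ioi 0, φ x)) := by
      simp_rw [posMass_sub_posMass_neg hφ]
      exact intervalIntegral_tendsto_integral_Ioi (0 : ℝ) hφ.integrableOn tendsto_id
    rw [h0] at h1
    exact sub_eq_zero.1 (tendsto_nhds_unique
      ((tendsto_posMass hφ).sub (tendsto_posMass hφ.neg)) h1)
  have := hfstep.2.to_subtype
  have := hgstep.2.to_subtype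
  set I₀ := fun i j => matched φ (valueCell f g) α i j
  set J₀ := fun i j => matched (-φ) (valueCell f g) (-α) j i
  set E : Set ℝ := {x | 0 < x ∧ f x ≠ g x ∧ ∀ i j, x ∉ I₀ i j ∧ x ∉ J₀ i j}
  have hEc : E.Countable := by
    refine ((hcell.countable_unmatched hφ hlim).union (hcell.neg.countable_unmatched hφ.neg
      (by rw [neg_neg]; exact hlim.symm))).mono ?_
    rintro x ⟨hx0, hne, hx⟩
    have hφx : φ x = f x - g x := by simp [hφdef, hx0]
    rcases lt_or_gt_of_ne hne with hlt | hlt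
    · exact Or.inr ⟨hx0, by rw [Pi.neg_apply, hφx]; linarith, fun i j => (hx j i).2⟩
    · exact Or.inl ⟨hx0, by rw [hφx]; linarith, fun i j => (hx i j).1⟩
  have := hEc.to_subtype
  have hI₀f : ∀ i j x, x ∈ I₀ i j → 0 < x ∧ g x < f x := fun i j x hx => by
    have h1 := matched_subset _ _ _ _ _ hx
    have h2 : 0 < (i.1 : ℝ) - i.2.1 := hx.2.1
    refine ⟨h1.1, ?_⟩
    rw [h1.2.1, h1.2.2.1]
    linarith
  have hJ₀f : ∀ i j x, x ∈ J₀ i j → 0 < x ∧ f x < g x := fun i j x hx => by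
    have h1 := matched_subset _ _ _ _ _ hx
    have h2 : 0 < -((j.1 : ℝ) - j.2.1) := hx.2.1
    refine ⟨h1.1, ?_⟩
    rw [h1.2.1, h1.2.2.1]
    linarith
  let Z : range f × range g × ℕ → Set ℝ := fun i => {x | x ∈ valueCell f g i ∧ f x = g x}
  let A : ((range f × range g × ℕ) × (range f × range g × ℕ)) ⊕
      (range f × range g × ℕ) ⊕ E → Set ℝ :=
    Sum.elim (fun ij => I₀ ij.1 ij.2) (Sum.elim Z fun x => {(x : ℝ)})
  let B : ((range f × range g × ℕ) × (range f × range g × ℕ)) ⊕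
      (range f × range g × ℕ) ⊕ E → Set ℝ :=
    Sum.elim (fun ij => J₀ ij.1 ij.2) (Sum.elim (fun _ => ∅) fun _ => ∅)
  have hpair : ∀ k, IsMatchedPair f g (A k) (B k) := by
    rintro (⟨i, j⟩ | i | ⟨x, hx⟩)
    · exact isMatchedPair_matched hf0 hg0 hfdec hgdec (fun _ => rfl) hcell hφ hle i j
    · have hZ : Z i = ∅ ∨ Z i = valueCell f g i := by
        by_cases hi : (i.1 : ℝ) = i.2.1
        · exact Or.inr (Subset.antisymm (fun x hx => hx.1)
            fun x hx => ⟨hx, by rw [hx.2.1, hx.2.2.1, hi]⟩)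
        · exact Or.inl (eq_empty_of_forall_notMem fun x hx =>
            hi (by rw [← hx.1.2.1, ← hx.1.2.2.1, hx.2]))
      refine isMatchedPair_of_eq (c := i.1) (isBoundedInterval_of_subset_valueCell ?_
        fun x hx => hx.1) (fun x hx => hx.1.2.1) (fun x hx => hx.2 ▸ hx.1.2.1)
      change (Z i).OrdConnected
      rcases hZ with hZ | hZ <;> rw [hZ]
      · exact ordConnected_empty
      · exact hcell.ordConnected i
    · exact isMatchedPair_singleton hf0 hg0 hx.1
  have hunique : ∀ k l x, x ∈ A k ∪ B k → x ∈ A l ∪ B l → k = l := by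
    have hpz : ∀ i j i' x, x ∈ I₀ i j ∪ J₀ i j → x ∈ Z i' → False := by
      rintro i j i' x (hx | hx) hx'
      · exact (hI₀f _ _ _ hx).2.ne' hx'.2
      · exact (hJ₀f _ _ _ hx).2.ne hx'.2
    have hpE : ∀ i j x, x ∈ I₀ i j ∪ J₀ i j → x ∈ E → False := by
      rintro i j x (hx | hx) hx'
      · exact (hx'.2.2 _ _).1 hx
      · exact (hx'.2.2 _ _).2 hx
    rintro (⟨i, j⟩ | i | ⟨y, hy⟩) (⟨i', j'⟩ | i' | ⟨y', hy'⟩) x hx hx' <;>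
      simp only [A, B, Sum.elim_inl, Sum.elim_inr, union_empty] at hx hx'
    · rcases hx with hx | hx <;> rcases hx' with hx' | hx'
      · obtain ⟨rfl, rfl⟩ := hcell.index_eq_of_matched hφ hx hx'
        rfl
      · exact absurd (hI₀f _ _ _ hx).2 (hJ₀f _ _ _ hx').2.not_gt
      · exact absurd (hJ₀f _ _ _ hx).2 (hI₀f _ _ _ hx').2.not_gt
      · obtain ⟨rfl, rfl⟩ := hcell.neg.index_eq_of_matched hφ.neg hx hx'
        rfl
    · exact (hpz i j i' x hx hx').elim
    · exact (hpE i j x hx (mem_singleton_iff.1 hx' ▸ hy')).elim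
    · exact (hpz i' j' i x hx' hx).elim
    · rw [hcell.index_unique i i' x hx.1 hx'.1]
    · exact (hy'.2.1 (mem_singleton_iff.1 hx' ▸ hx.2)).elim
    · exact (hpE i' j' x hx' (mem_singleton_iff.1 hx ▸ hy)).elim
    · exact (hy.2.1 (mem_singleton_iff.1 hx ▸ hx'.2)).elim
    · have : y = y' := (mem_singleton_iff.1 hx).symm.trans (mem_singleton_iff.1 hx')
      subst this
      rfl
  obtain ⟨I, J, hIJ, hdisj, hunion⟩ := exists_nat_indexing (isMatchedPair_empty f g) hpair hunique
  refine ⟨I, J, fun k => ⟨(hIJ k).left, (hIJ k).right, (hIJ k).disjoint⟩, hdisj, ?_,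
    fun k => ⟨(hIJ k).f_left, (hIJ k).f_right, (hIJ k).g_left, (hIJ k).g_right⟩,
    fun k => ⟨(hIJ k).lintegral_eq, (hIJ k).headMaj⟩⟩
  rw [hunion]
  refine Subset.antisymm (iUnion_subset ?_) ?_
  · rintro (⟨i, j⟩ | i | ⟨y, hy⟩) x hx <;>
      simp only [A, B, Sum.elim_inl, Sum.elim_inr, union_empty] at hx
    · rcases hx with hx | hx
      · exact (hI₀f _ _ _ hx).1
      · exact (hJ₀f _ _ _ hx).1
    · exact hx.1.1
    · exact mem_singleton_iff.1 hx ▸ hy.1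
  · intro x hx
    by_cases hxE : x ∈ E
    · exact mem_iUnion.2 ⟨.inr (.inr ⟨x, hxE⟩), Or.inl rfl⟩
    by_cases hfg : f x = g x
    · obtain ⟨i, hi⟩ := hcell.exists_mem x hx
      exact mem_iUnion.2 ⟨.inr (.inl i), Or.inl ⟨hi, hfg⟩⟩
    have : ∃ i j, x ∈ I₀ i j ∪ J₀ i j := by
      by_contra! hcon
      exact hxE ⟨hx, hfg, fun i j => not_or.1 (hcon i j)⟩
    obtain ⟨i, j, hij⟩ := this
    exact mem_iUnion.2 ⟨.inl (i, j), hij⟩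
end
end

section
/- Let f, g ∈ L_0 + L_1 on (0,∞) be such that f = μ(f), g = μ(g) and g ≺≺_tl f. Then there exists a collection {Δ_k}_{k≥0} of pairwise disjoint measurable subsets of (0,∞) such that: (i) for every k, ∫_{Δ_k} g = ∫_{Δ_k} f and g·χ_{Δ_k} ≺≺_tl f·χ_{Δ_k} (equivalently, f·χ_{Δ_k} head-majorizes g·χ_{Δ_k} with equal integrals); (ii) g ≤ f on the complement of ∪_{k≥0} Δ_k. -/
open MeasureTheory ENNReal Set Filter

noncomputable section

namespace CSZ

/-- `f` coincides with its decreasing rearrangement: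
`f` is nonnegative, decreasing on `(0,∞)` and right-continuous. -/
def ShapeDR (f : ℝ → ℝ) : Prop :=
  (∀ x, 0 ≤ f x) ∧ AntitoneOn f (Set.Ioi 0) ∧
    ∀ x ∈ Set.Ioi (0:ℝ), ContinuousWithinAt f (Set.Ici x) x

end CSZ

namespace CSZ

/-! ### Disjointification of a sequence of classes -/

theorem exists_disjoint_seq {α : Type*} {D : ℕ → Set α}
    (h : ∀ i j, D i = D j ∨ Disjoint (D i) (D j)) :
    ∃ Δ : ℕ → Set α, (∀ k, Δ k = ∅ ∨ Δ k = D k) ∧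
      (∀ k l, k ≠ l → Disjoint (Δ k) (Δ l)) ∧ ⋃ k, Δ k = ⋃ k, D k := by
  refine ⟨disjointed D, fun k => ?_, fun k l hkl => disjoint_disjointed D hkl, iUnion_disjointed⟩
  rw [disjointed_apply]
  by_cases hk : ∃ j < k, D j = D k
  · obtain ⟨j, hj, hjk⟩ := hk
    left
    rw [← hjk]
    refine sdiff_eq_bot_iff.2 ?_
    exact Finset.le_sup (f := D) (Finset.mem_Iio.2 hj)
  · right
    refine sdiff_eq_left.2 (Finset.disjoint_sup_right.2 fun j hj => ?_)
    exact ((h j k).resolve_left fun e => hk ⟨j, Finset.mem_Iio.1 hj, e⟩).symm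

/-! ### Integrals over order-connected sets -/

theorem setLIntegral_le_of_forall_Ioc {φ : ℝ → ℝ≥0∞} {C : Set ℝ} (hC : C.OrdConnected)
    {B : ℝ≥0∞} (h : ∀ y ∈ C, ∀ x ∈ C, ∫⁻ s in Ioc y x, φ s ≤ B) :
    ∫⁻ s in C, φ s ≤ B := by
  let ι := {p : ℚ × ℚ // (p.1 : ℝ) ∈ C ∧ (p.2 : ℝ) ∈ C}
  let A : ι → Set ℝ := fun p => Ioc (p.1.1 : ℝ) p.1.2
  have hdir : Directed (· ⊆ ·) A := by
    rintro ⟨⟨a, b⟩, ha, hb⟩ ⟨⟨c, d⟩, hc, hd⟩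
    refine ⟨⟨(min a c, max b d), ?_, ?_⟩, ?_, ?_⟩
    · rcases min_choice a c with e | e <;> simpa [e]
    · rcases max_choice b d with e | e <;> simpa [e]
    · exact Ioc_subset_Ioc (by simp) (by simp)
    · exact Ioc_subset_Ioc (by simp) (by simp)
  have hsub : {x ∈ C | ∃ y ∈ C, y < x} ∩ {x ∈ C | ∃ y ∈ C, x < y} ⊆ ⋃ p, A p := by
    rintro x ⟨⟨hx, y, hy, hyx⟩, -, z, hz, hxz⟩
    obtain ⟨q, hq1, hq2⟩ := exists_rat_btwn hyx
    obtain ⟨r, hr1, hr2⟩ := exists_rat_btwn hxz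
    exact mem_iUnion.2 ⟨⟨(q, r), hC.out hy hx ⟨hq1.le, hq2.le⟩, hC.out hx hz ⟨hr1.le, hr2.le⟩⟩,
      hq2, hr1.le⟩
  have h1 : ({x ∈ C | ∀ y ∈ C, x ≤ y} : Set ℝ).Subsingleton := fun x hx y hy =>
    le_antisymm (hx.2 y hy.1) (hy.2 x hx.1)
  have h2 : ({x ∈ C | ∀ y ∈ C, y ≤ x} : Set ℝ).Subsingleton := fun x hx y hy =>
    le_antisymm (hy.2 x hx.1) (hx.2 y hy.1)
  have hae : C ≤ᵐ[volume] ⋃ p, A p := by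
    have n1 := h1.measure_zero (volume : Measure ℝ)
    have n2 := h2.measure_zero (volume : Measure ℝ)
    filter_upwards [measure_eq_zero_iff_ae_notMem.1 n1, measure_eq_zero_iff_ae_notMem.1 n2]
      with x hx1 hx2 hxC
    simp only [not_and, not_forall, not_le] at hx1 hx2
    obtain ⟨y, hy, hyx⟩ := hx1 hxC
    obtain ⟨z, hz, hzx⟩ := hx2 hxC
    exact hsub ⟨⟨hxC, y, hy, hyx⟩, hxC, z, hz, hzx⟩
  calc ∫⁻ s in C, φ s ≤ ∫⁻ s in ⋃ p, A p, φ s := lintegral_mono_set' hae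
    _ = ⨆ p, ∫⁻ s in A p, φ s := setLIntegral_iUnion_of_directed _ hdir
    _ ≤ B := iSup_le fun p => h _ p.2.1 _ p.2.2

/-! ### Rearrangement of a function decreasing on a half line -/

theorem setLIntegral_Ioi_comp_add (φ : ℝ → ℝ≥0∞) (a t : ℝ) :
    ∫⁻ s in Ioi t, φ (a + s) = ∫⁻ s in Ioi (a + t), φ s := by
  have := (measurePreserving_add_left volume a).setLIntegral_comp_preimage_emb
    (MeasurableEquiv.addLeft a).measurableEmbedding φ (Ioi (a + t))
  simpa using this

theorem m0_superlevel_le_of_antitoneOn {k : ℝ → ℝ} {a t : ℝ} (hk : ∀ x, 0 ≤ k x)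
    (hanti : AntitoneOn k (Ioi a)) (hzero : ∀ x, 0 < x → x < a → k x = 0) (ht : 0 < t) :
    m0 {x | k (a + t) < |k x|} ≤ ENNReal.ofReal t := by
  have hsub : {x | k (a + t) < |k x|} ∩ Ioi 0 ⊆ Ico a (a + t) := by
    rintro x ⟨hx, hx0⟩
    rw [mem_ofPred_eq, abs_of_nonneg (hk x)] at hx
    refine ⟨not_lt.1 fun hxa => ?_, not_le.1 fun hxt => ?_⟩
    · rw [hzero x hx0 hxa] at hx
      exact (hk _).not_gt hx
    · exact (hanti (mem_Ioi.2 (by linarith)) (mem_Ioi.2 (by linarith)) hxt).not_gt hx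
  rw [m0, Measure.restrict_apply' measurableSet_Ioi]
  refine (measure_mono hsub).trans ?_
  simp

theorem mu_le_of_antitoneOn {k : ℝ → ℝ} {a t : ℝ} (hk : ∀ x, 0 ≤ k x)
    (hanti : AntitoneOn k (Ioi a)) (hzero : ∀ x, 0 < x → x < a → k x = 0) (ht : 0 < t) :
    mu k t ≤ k (a + t) :=
  csInf_le ⟨0, fun _ hs => hs.1⟩ ⟨hk _, m0_superlevel_le_of_antitoneOn hk hanti hzero ht⟩

theorem le_mu_of_antitoneOn {k : ℝ → ℝ} {a t u : ℝ} (ha : 0 ≤ a) (hk : ∀ x, 0 ≤ k x)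
    (hanti : AntitoneOn k (Ioi a)) (hzero : ∀ x, 0 < x → x < a → k x = 0) (ht : 0 < t)
    (hu : a + t < u) : k u ≤ mu k t := by
  refine le_csInf ⟨k (a + t), hk _, m0_superlevel_le_of_antitoneOn hk hanti hzero ht⟩ ?_
  rintro s ⟨-, hs⟩
  by_contra! hsu
  have hsub : Ioc a u ⊆ {x | s < |k x|} ∩ Ioi 0 := by
    rintro x ⟨hx1, hx2⟩
    refine ⟨?_, mem_Ioi.2 (ha.trans_lt hx1)⟩
    rw [mem_ofPred_eq, abs_of_nonneg (hk x)]
    exact hsu.trans_le (hanti hx1 (mem_Ioi.2 (by linarith)) hx2)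
  rw [m0, Measure.restrict_apply' measurableSet_Ioi] at hs
  have := (measure_mono hsub).trans hs
  rw [Real.volume_Ioc, ENNReal.ofReal_le_ofReal_iff ht.le] at this
  linarith

theorem setLIntegral_mu_of_antitoneOn {k : ℝ → ℝ} {a t : ℝ} (ha : 0 ≤ a) (hk : ∀ x, 0 ≤ k x)
    (hanti : AntitoneOn k (Ioi a)) (hzero : ∀ x, 0 < x → x < a → k x = 0) (ht : 0 < t) :
    ∫⁻ s in Ioi t, ENNReal.ofReal (mu k s) = ∫⁻ s in Ioi (a + t), ENNReal.ofReal (k s) := by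
  apply le_antisymm
  · rw [← setLIntegral_Ioi_comp_add (fun s => ENNReal.ofReal (k s))]
    refine setLIntegral_mono' measurableSet_Ioi fun s hs => ?_
    exact ENNReal.ofReal_le_ofReal (mu_le_of_antitoneOn hk hanti hzero (ht.trans hs))
  · refine setLIntegral_le_of_forall_Ioc ordConnected_Ioi fun y hy x _ => ?_
    refine (lintegral_mono_set Ioc_subset_Ioi_self).trans ?_
    have e : y = (y - t) + t := by ring
    rw [e, ← setLIntegral_Ioi_comp_add (fun s => ENNReal.ofReal (k s))]
    refine setLIntegral_mono' measurableSet_Ioi fun s hs => ?_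
    refine ENNReal.ofReal_le_ofReal (le_mu_of_antitoneOn ha hk hanti hzero (ht.trans hs) ?_)
    have := mem_Ioi.1 hy
    linarith

theorem setLIntegral_mu_indicator {f : ℝ → ℝ} (hf : ShapeDR f) {C : Set ℝ}
    (hC : C.OrdConnected) (hC0 : C ⊆ Ioi 0) (hne : C.Nonempty) {t : ℝ} (ht : 0 < t) :
    ∫⁻ s in Ioi t, ENNReal.ofReal (mu (C.indicator f) s) =
      ∫⁻ s in C ∩ Ioi (sInf C + t), ENNReal.ofReal (f s) := by
  have hbdd : BddBelow C := ⟨0, fun x hx => (hC0 hx).le⟩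
  have hk : ∀ x, 0 ≤ C.indicator f x := fun x => indicator_nonneg (fun y _ => hf.1 y) x
  rw [setLIntegral_mu_of_antitoneOn (a := sInf C) (le_csInf hne fun x hx => (hC0 hx).le) hk
    ?_ ?_ ht]
  · have : (fun s => ENNReal.ofReal (C.indicator f s)) =
        C.indicator fun s => ENNReal.ofReal (f s) := by
      ext s
      by_cases hs : s ∈ C <;> simp [hs]
    rw [this, setLIntegral_indicator hC.measurableSet]
  · intro x hx y hy hxy
    by_cases hyC : y ∈ C
    · obtain ⟨z, hz, hzx⟩ := exists_lt_of_csInf_lt hne hx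
      have hxC : x ∈ C := hC.out hz hyC ⟨hzx.le, hxy⟩
      rw [indicator_of_mem hyC, indicator_of_mem hxC]
      exact hf.2.1 (hC0 hxC) (hC0 hyC) hxy
    · rw [indicator_of_notMem hyC]
      exact hk x
  · intro x _ hx
    exact indicator_of_notMem (fun h => (csInf_le hbdd h).not_gt hx) f

theorem setLIntegral_mu {f : ℝ → ℝ} (hf : ShapeDR f) {t : ℝ} (ht : 0 < t) :
    ∫⁻ s in Ioi t, ENNReal.ofReal (mu f s) = ∫⁻ s in Ioi t, ENNReal.ofReal (f s) := by
  have := setLIntegral_mu_of_antitoneOn le_rfl hf.1 hf.2.1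
    (fun x h h' => absurd h h'.not_gt) ht
  simpa using this

theorem ShapeDR.integrableOn_Ioi {f : ℝ → ℝ} (hf : f ∈ sumSet L0S (LpS 1)) (hs : ShapeDR f)
    {t : ℝ} (ht : 0 < t) : IntegrableOn f (Ioi t) := by
  obtain ⟨u, ⟨hum, hu⟩, v, ⟨hvm, hv⟩, rfl⟩ := hf
  have hsupp : MeasurableSet (Function.support u) := measurableSet_support hum
  refine ⟨(hum.add hvm).aestronglyMeasurable, ?_⟩
  rw [hasFiniteIntegral_iff_ofReal (ae_of_all _ hs.1)]
  have hle : ∀ x ∈ Ioi t, ENNReal.ofReal ((u + v) x) ≤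
      (Function.support u).indicator (fun _ => ENNReal.ofReal ((u + v) t)) x +
        ENNReal.ofReal (|v x| ^ (1 : ℝ)) := by
    intro x hx
    by_cases hxu : x ∈ Function.support u
    · rw [indicator_of_mem hxu]
      exact le_add_right (ENNReal.ofReal_le_ofReal (hs.2.1 ht (ht.trans hx) (le_of_lt hx)))
    · rw [indicator_of_notMem hxu, zero_add, Real.rpow_one]
      rw [Function.notMem_support] at hxu
      refine ENNReal.ofReal_le_ofReal ?_
      simpa [hxu] using le_abs_self (v x)
  have hmono : Ioi t ⊆ Ioi 0 := Ioi_subset_Ioi ht.le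
  refine (setLIntegral_mono' measurableSet_Ioi hle).trans_lt ?_
  rw [lintegral_add_left (measurable_const.indicator hsupp)]
  refine ENNReal.add_lt_top.2 ⟨?_, (lintegral_mono_set hmono).trans_lt hv⟩
  rw [lintegral_indicator_const hsupp]
  refine ENNReal.mul_lt_top ENNReal.ofReal_lt_top (lt_of_le_of_lt ?_ hu)
  exact Measure.restrict_mono hmono le_rfl _

/-! ### Running minima and the intervals between them -/

/-- The points of `(0,∞)` at which `H` attains its minimum over `(0,z]`. -/
def runningMin (H : ℝ → ℝ) : Set ℝ := {z | 0 < z ∧ ∀ s, 0 < s → s ≤ z → H z ≤ H s}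

/-- The points of `(0,∞)` that no element of `runningMin H` separates from `q`; an element `z` of
`runningMin H` is regarded as lying to the right of the gap it creates. -/
def minClass (H : ℝ → ℝ) (q : ℝ) : Set ℝ := {x | 0 < x ∧ ∀ z ∈ uIoc x q, z ∉ runningMin H}

theorem minClass_subset (H : ℝ → ℝ) (q : ℝ) : minClass H q ⊆ Ioi 0 := fun _ hx => hx.1

theorem self_mem_minClass (H : ℝ → ℝ) {q : ℝ} (hq : 0 < q) : q ∈ minClass H q :=
  ⟨hq, by simp⟩

theorem minClass_eq_of_mem {H : ℝ → ℝ} {p q : ℝ} (hp : p ∈ minClass H q) :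
    minClass H p = minClass H q := by
  obtain ⟨-, h⟩ := hp
  ext x
  refine and_congr_right fun _ => ⟨fun hx z hz => ?_, fun hx z hz => ?_⟩ <;>
  · simp only [mem_uIoc] at h hx hz
    grind

theorem minClass_eq_or_disjoint (H : ℝ → ℝ) (p q : ℝ) :
    minClass H p = minClass H q ∨ Disjoint (minClass H p) (minClass H q) := by
  by_cases h : Disjoint (minClass H p) (minClass H q)
  · exact Or.inr h
  · obtain ⟨x, hx, hx'⟩ := not_disjoint_iff.1 h
    exact Or.inl ((minClass_eq_of_mem hx).symm.trans (minClass_eq_of_mem hx'))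

theorem notMem_runningMin_of_mem_minClass {H : ℝ → ℝ} {q x y z : ℝ} (hx : x ∈ minClass H q)
    (hy : y ∈ minClass H q) (hz : z ∈ Ioc y x) : z ∉ runningMin H := by
  rw [← minClass_eq_of_mem hx] at hy
  exact hy.2 z (mem_uIoc.2 (Or.inl hz))

theorem mem_minClass_of_Ioc {H : ℝ → ℝ} {q x y : ℝ} (hx : x ∈ minClass H q) (hy : 0 < y)
    (h : ∀ z ∈ Ioc y x, z ∉ runningMin H) (hyx : y ≤ x) : y ∈ minClass H q := by
  rw [← minClass_eq_of_mem hx]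
  exact ⟨hy, by rwa [uIoc_of_le hyx]⟩

theorem mem_minClass_of_Ioc' {H : ℝ → ℝ} {q x y : ℝ} (hx : x ∈ minClass H q) (hy : 0 < y)
    (h : ∀ z ∈ Ioc x y, z ∉ runningMin H) (hxy : x ≤ y) : y ∈ minClass H q := by
  rw [← minClass_eq_of_mem hx]
  exact ⟨hy, by rwa [uIoc_of_ge hxy]⟩

theorem ordConnected_minClass (H : ℝ → ℝ) (q : ℝ) : (minClass H q).OrdConnected := by
  refine ⟨fun x hx y hy z hz => ?_⟩
  exact mem_minClass_of_Ioc hy (hx.1.trans_le hz.1)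
    (fun w hw => notMem_runningMin_of_mem_minClass hy hx ⟨hz.1.trans_lt hw.1, hw.2⟩) hz.2

/-- Going to the left inside a class, `H` drops to or below any value it takes in the class. -/
theorem exists_mem_minClass_le {H : ℝ → ℝ} (hH : ContinuousOn H (Ioi 0)) {q x y : ℝ}
    (hx : x ∈ minClass H q) (hy : y ∈ minClass H q) (hyx : y ≤ x) :
    ∃ s ∈ minClass H q, s ≤ y ∧ H s ≤ H x := by
  by_cases hz : ∃ z ∈ runningMin H, z ≤ x
  · obtain ⟨z, hz, hzx⟩ := hz
    have hcont : ContinuousOn H (Icc z x) := hH.mono fun w hw => hz.1.trans_le hw.1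
    obtain ⟨c, hc, hcmin⟩ := isCompact_Icc.exists_isMinOn (nonempty_Icc.2 hzx) hcont
    have hcomp : IsCompact (Icc z x ∩ H ⁻¹' Iic (H c)) :=
      isCompact_Icc.of_isClosed_subset
        (hcont.preimage_isClosed_of_isClosed isClosed_Icc isClosed_Iic) inter_subset_left
    obtain ⟨a, ⟨ha, hac⟩, hamax⟩ := hcomp.exists_isGreatest ⟨c, hc, le_refl (H c)⟩
    have hamin : ∀ w ∈ Icc z x, H a ≤ H w := fun w hw => le_trans hac (hcmin hw)
    have ha0 : 0 < a := hz.1.trans_le ha.1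
    have haZ : a ∈ runningMin H := by
      refine ⟨ha0, fun s hs hsa => ?_⟩
      rcases le_total z s with h | h
      · exact hamin s ⟨h, hsa.trans ha.2⟩
      · exact (hamin z ⟨le_rfl, hzx⟩).trans (hz.2 s hs h)
    have haC : a ∈ minClass H q := by
      refine mem_minClass_of_Ioc hx ha0 (fun w hw hwZ => ?_) ha.2
      refine hw.1.not_ge (hamax ⟨⟨ha.1.trans hw.1.le, hw.2⟩, ?_⟩)
      exact (hwZ.2 a ha0 hw.1.le).trans hac
    refine ⟨a, haC, not_lt.1 fun hya => ?_, hamin x ⟨hzx, le_rfl⟩⟩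
    exact notMem_runningMin_of_mem_minClass hx hy ⟨hya, ha.2⟩ haZ
  · push Not at hz
    have hcont : ContinuousOn H (Icc y x) := hH.mono fun w hw => hy.1.trans_le hw.1
    obtain ⟨p, hp, hpmin⟩ := isCompact_Icc.exists_isMinOn (nonempty_Icc.2 hyx) hcont
    have hp0 : 0 < p := hy.1.trans_le hp.1
    have hpZ : p ∉ runningMin H := fun h => (hz p h).not_ge hp.2
    obtain ⟨s, hs, hsp, hlt⟩ : ∃ s, 0 < s ∧ s ≤ p ∧ H s < H p := by
      by_contra! hcon
      exact hpZ ⟨hp0, hcon⟩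
    have hsy : s ≤ y := not_lt.1 fun h =>
      hlt.not_ge (hpmin (show s ∈ Icc y x from ⟨h.le, hsp.trans hp.2⟩))
    refine ⟨s, mem_minClass_of_Ioc hx hs (fun w hw hwZ => (hz w hwZ).not_ge hw.2)
      (hsy.trans hyx), hsy, hlt.le.trans (hpmin ⟨hyx, le_rfl⟩)⟩

/-- To the right of a point `t`, a class is either all of `(t,∞)` or an interval at whose end
`H` is at most `H t`. -/
theorem minClass_inter_Ioi {H : ℝ → ℝ} (hH : ContinuousOn H (Ioi 0)) {q t : ℝ}
    (ht : t ∈ minClass H q) :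
    minClass H q ∩ Ioi t = Ioi t ∨
      ∃ b, t ≤ b ∧ H b ≤ H t ∧ (minClass H q ∩ Ioi t : Set ℝ) =ᵐ[volume] Ioc t b := by
  by_cases hz : (runningMin H ∩ Ioi t).Nonempty
  · right
    have hbdd : BddBelow (runningMin H ∩ Ioi t) := ⟨t, fun z hz => le_of_lt hz.2⟩
    set b := sInf (runningMin H ∩ Ioi t) with hb
    have htb : t ≤ b := le_csInf hz fun z hz => le_of_lt hz.2
    refine ⟨b, htb, ?_, ?_⟩
    · have hcont : ContinuousOn H (Ici t) := hH.mono fun w hw => ht.1.trans_le hw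
      have hclosed : IsClosed (Ici t ∩ H ⁻¹' Iic (H t)) :=
        hcont.preimage_isClosed_of_isClosed isClosed_Ici isClosed_Iic
      have hsub : runningMin H ∩ Ioi t ⊆ Ici t ∩ H ⁻¹' Iic (H t) := fun z hz =>
        ⟨mem_Ici.2 (le_of_lt hz.2), hz.1.2 t ht.1 (le_of_lt hz.2)⟩
      exact (closure_minimal hsub hclosed (csInf_mem_closure hz hbdd)).2
    · have hne : ∀ᵐ x : ℝ, x ≠ b := Measure.ae_ne volume b
      refine Filter.eventuallyEq_set.2
        (hne.mono fun x hxb => ⟨fun hx => ⟨hx.2, ?_⟩, fun hx => ⟨?_, hx.1⟩⟩)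
      · refine not_lt.1 fun hbx => ?_
        obtain ⟨z, hz, hzx⟩ := exists_lt_of_csInf_lt hz hbx
        exact notMem_runningMin_of_mem_minClass hx.1 ht ⟨hz.2, hzx.le⟩ hz.1
      · refine mem_minClass_of_Ioc' ht (ht.1.trans hx.1) (fun w hw hwZ => ?_) hx.1.le
        have hxb' : x < b := lt_of_le_of_ne hx.2 hxb
        exact (hw.2.trans_lt hxb').not_ge (csInf_le hbdd ⟨hwZ, hw.1⟩)
  · left
    refine inter_eq_right.2 fun x hx => ?_
    exact mem_minClass_of_Ioc' ht (ht.1.trans hx) (fun w hw hwZ => hz ⟨w, hwZ, hw.1⟩)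
      (le_of_lt hx)

/-! ### The tail integral of a difference -/

section Tail

variable {f g : ℝ → ℝ}

/-- The tail integral `∫_t^∞ (f - g)`. -/
def tailDiff (f g : ℝ → ℝ) (t : ℝ) : ℝ := ∫ s in Ioi t, (f s - g s)

theorem continuousOn_tailDiff (hf : ∀ t, 0 < t → IntegrableOn f (Ioi t))
    (hg : ∀ t, 0 < t → IntegrableOn g (Ioi t)) : ContinuousOn (tailDiff f g) (Ioi 0) := by
  intro x hx
  have hx : 0 < x := hx
  have hint : IntegrableOn (fun s => f s - g s) (Ioi (x / 2)) :=
    (hf _ (half_pos hx)).sub (hg _ (half_pos hx))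
  exact (hint.continuousOn_Ici_primitive_Ioi.continuousAt
    (Ici_mem_nhds (half_lt_self hx))).continuousWithinAt

theorem tailDiff_sub (hf : ∀ t, 0 < t → IntegrableOn f (Ioi t))
    (hg : ∀ t, 0 < t → IntegrableOn g (Ioi t)) {s x : ℝ} (hs : 0 < s) (hsx : s ≤ x) :
    tailDiff f g s - tailDiff f g x = (∫ r in Ioc s x, f r) - ∫ r in Ioc s x, g r := by
  have hint : IntegrableOn (fun s => f s - g s) (Ioi s) := (hf _ hs).sub (hg _ hs)
  have := intervalIntegral.integral_interval_add_Ioi hint (hint.mono_set (Ioi_subset_Ioi hsx))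
  rw [intervalIntegral.integral_of_le hsx, integral_sub
    ((hf s hs).mono_set Ioc_subset_Ioi_self) ((hg s hs).mono_set Ioc_subset_Ioi_self)] at this
  rw [tailDiff, tailDiff]
  linarith

theorem ofReal_setIntegral_Ioc (hf0 : ∀ x, 0 ≤ f x) (hf : ∀ t, 0 < t → IntegrableOn f (Ioi t))
    {s x : ℝ} (hs : 0 < s) :
    ∫⁻ r in Ioc s x, ENNReal.ofReal (f r) = ENNReal.ofReal (∫ r in Ioc s x, f r) :=
  (ofReal_integral_eq_lintegral_ofReal ((hf s hs).mono_set Ioc_subset_Ioi_self)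
    (ae_of_all _ hf0)).symm

theorem setLIntegral_Ioc_le_of_tailDiff_le (hf0 : ∀ x, 0 ≤ f x) (hg0 : ∀ x, 0 ≤ g x)
    (hf : ∀ t, 0 < t → IntegrableOn f (Ioi t)) (hg : ∀ t, 0 < t → IntegrableOn g (Ioi t))
    {s x : ℝ} (hs : 0 < s) (hsx : s ≤ x) (h : tailDiff f g s ≤ tailDiff f g x) :
    ∫⁻ r in Ioc s x, ENNReal.ofReal (f r) ≤ ∫⁻ r in Ioc s x, ENNReal.ofReal (g r) := by
  rw [ofReal_setIntegral_Ioc hf0 hf hs, ofReal_setIntegral_Ioc hg0 hg hs]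
  refine ENNReal.ofReal_le_ofReal ?_
  linarith [tailDiff_sub hf hg hs hsx]

theorem setLIntegral_Ioc_le_of_le_tailDiff (hf0 : ∀ x, 0 ≤ f x) (hg0 : ∀ x, 0 ≤ g x)
    (hf : ∀ t, 0 < t → IntegrableOn f (Ioi t)) (hg : ∀ t, 0 < t → IntegrableOn g (Ioi t))
    {s x : ℝ} (hs : 0 < s) (hsx : s ≤ x) (h : tailDiff f g x ≤ tailDiff f g s) :
    ∫⁻ r in Ioc s x, ENNReal.ofReal (g r) ≤ ∫⁻ r in Ioc s x, ENNReal.ofReal (f r) := by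
  rw [ofReal_setIntegral_Ioc hf0 hf hs, ofReal_setIntegral_Ioc hg0 hg hs]
  refine ENNReal.ofReal_le_ofReal ?_
  linarith [tailDiff_sub hf hg hs hsx]

theorem tailDiff_lt (hf : ∀ t, 0 < t → IntegrableOn f (Ioi t))
    (hg : ∀ t, 0 < t → IntegrableOn g (Ioi t)) {s x : ℝ} (hs : 0 < s) (hsx : s < x)
    (h : ∀ r ∈ Ioo s x, f r < g r) : tailDiff f g s < tailDiff f g x := by
  have hfi := (hf s hs).mono_set (show Ioc s x ⊆ Ioi s from Ioc_subset_Ioi_self)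
  have hgi := (hg s hs).mono_set (show Ioc s x ⊆ Ioi s from Ioc_subset_Ioi_self)
  have hpos := intervalIntegral.intervalIntegral_pos_of_pos_on
    ((intervalIntegrable_iff_integrableOn_Ioc_of_le hsx.le).2 (hgi.sub hfi))
    (fun r hr => sub_pos.2 (h r hr)) hsx
  rw [intervalIntegral.integral_of_le hsx.le] at hpos
  have e : ∫ r in Ioc s x, (g - f) r = (∫ r in Ioc s x, g r) - ∫ r in Ioc s x, f r :=
    integral_sub hgi hfi
  have := tailDiff_sub hf hg hs hsx.le
  simp only [Pi.sub_apply] at hpos e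
  linarith

/-- On the part of a class to the right of one of its points, the integral of `g` is at most that
of `f`. -/
theorem setLIntegral_minClass_inter_Ioi_le (hf0 : ∀ x, 0 ≤ f x) (hg0 : ∀ x, 0 ≤ g x)
    (hf : ∀ t, 0 < t → IntegrableOn f (Ioi t)) (hg : ∀ t, 0 < t → IntegrableOn g (Ioi t))
    (hmaj : ∀ t, 0 < t → ∫⁻ s in Ioi t, ENNReal.ofReal (g s) ≤ ∫⁻ s in Ioi t, ENNReal.ofReal (f s))
    {q t : ℝ} (ht : t ∈ minClass (tailDiff f g) q) :
    ∫⁻ s in minClass (tailDiff f g) q ∩ Ioi t, ENNReal.ofReal (g s) ≤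
      ∫⁻ s in minClass (tailDiff f g) q ∩ Ioi t, ENNReal.ofReal (f s) := by
  rcases minClass_inter_Ioi (continuousOn_tailDiff hf hg) ht with h | ⟨b, htb, hle, hae⟩
  · rw [h]
    exact hmaj t ht.1
  · rw [setLIntegral_congr hae, setLIntegral_congr hae]
    exact setLIntegral_Ioc_le_of_le_tailDiff hf0 hg0 hf hg ht.1 htb hle

theorem setLIntegral_minClass_eq (hf0 : ∀ x, 0 ≤ f x) (hg0 : ∀ x, 0 ≤ g x)
    (hf : ∀ t, 0 < t → IntegrableOn f (Ioi t)) (hg : ∀ t, 0 < t → IntegrableOn g (Ioi t))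
    (hmaj : ∀ t, 0 < t → ∫⁻ s in Ioi t, ENNReal.ofReal (g s) ≤ ∫⁻ s in Ioi t, ENNReal.ofReal (f s))
    (q : ℝ) :
    ∫⁻ s in minClass (tailDiff f g) q, ENNReal.ofReal (g s) =
      ∫⁻ s in minClass (tailDiff f g) q, ENNReal.ofReal (f s) := by
  have hoc := ordConnected_minClass (tailDiff f g) q
  apply le_antisymm <;> refine setLIntegral_le_of_forall_Ioc hoc fun y hy x hx => ?_
  · refine (lintegral_mono_set (t := minClass (tailDiff f g) q ∩ Ioi y) fun z hz =>
      ⟨hoc.out hy hx ⟨hz.1.le, hz.2⟩, hz.1⟩).trans ?_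
    refine (setLIntegral_minClass_inter_Ioi_le hf0 hg0 hf hg hmaj hy).trans ?_
    exact lintegral_mono_set inter_subset_left
  · rcases lt_or_ge x y with hxy | hyx
    · simp [Ioc_eq_empty_of_le hxy.le]
    obtain ⟨s, hs, hsy, hle⟩ := exists_mem_minClass_le (continuousOn_tailDiff hf hg) hx hy hyx
    refine (lintegral_mono_set (Ioc_subset_Ioc_left hsy)).trans ?_
    refine (setLIntegral_Ioc_le_of_tailDiff_le hf0 hg0 hf hg hs.1 (hsy.trans hyx) hle).trans ?_
    exact lintegral_mono_set fun z hz => hoc.out hs hx ⟨hz.1.le, hz.2⟩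

/-- A point at which `f < g` lies in the class of some positive rational. -/
theorem exists_rat_mem_minClass (hf : ∀ t, 0 < t → IntegrableOn f (Ioi t))
    (hg : ∀ t, 0 < t → IntegrableOn g (Ioi t)) {x : ℝ} (hx : 0 < x)
    (hfc : ContinuousWithinAt f (Ici x) x) (hgc : ContinuousWithinAt g (Ici x) x)
    (hlt : f x < g x) : ∃ q : ℚ, 0 < q ∧ x ∈ minClass (tailDiff f g) q := by
  have hev : ∀ᶠ y in nhdsWithin x (Ici x), f y < g y := hfc.eventually_lt hgc hlt
  obtain ⟨u, hxu, hu⟩ := (mem_nhdsGE_iff_exists_Ico_subset).1 hev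
  obtain ⟨q, hxq, hqu⟩ := exists_rat_btwn (mem_Ioi.1 hxu)
  refine ⟨q, by exact_mod_cast hx.trans hxq, hx, fun z hz hzZ => ?_⟩
  rw [uIoc_of_le hxq.le] at hz
  refine (hzZ.2 x hx hz.1.le).not_gt (tailDiff_lt hf hg hx hz.1 fun r hr => ?_)
  exact hu ⟨hr.1.le, hr.2.trans (hz.2.trans_lt hqu)⟩

end Tail

theorem tailMaj_indicator_minClass {f g : ℝ → ℝ} (hfs : ShapeDR f) (hgs : ShapeDR g)
    (hf : ∀ t, 0 < t → IntegrableOn f (Ioi t)) (hg : ∀ t, 0 < t → IntegrableOn g (Ioi t))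
    (hmaj : ∀ t, 0 < t → ∫⁻ s in Ioi t, ENNReal.ofReal (g s) ≤ ∫⁻ s in Ioi t, ENNReal.ofReal (f s))
    {q : ℝ} (hq : 0 < q) :
    TailMaj ((minClass (tailDiff f g) q).indicator g)
      ((minClass (tailDiff f g) q).indicator f) := by
  intro t ht
  set C := minClass (tailDiff f g) q with hC
  have hoc : C.OrdConnected := ordConnected_minClass _ q
  have hne : C.Nonempty := ⟨q, self_mem_minClass _ hq⟩
  rw [setLIntegral_mu_indicator hgs hoc (minClass_subset _ q) hne ht,
    setLIntegral_mu_indicator hfs hoc (minClass_subset _ q) hne ht]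
  by_cases h : sInf C + t ∈ C
  · exact setLIntegral_minClass_inter_Ioi_le hfs.1 hgs.1 hf hg hmaj h
  · have : C ∩ Ioi (sInf C + t) = ∅ := by
      refine eq_empty_of_forall_notMem fun x hx => h ?_
      obtain ⟨z, hz, hzx⟩ := exists_lt_of_csInf_lt hne (lt_add_of_pos_right (sInf C) ht)
      exact hoc.out hz hx.1 ⟨hzx.le, le_of_lt hx.2⟩
    simp [this]

end CSZ

open CSZ MeasureTheory ENNReal Set in
/-- third partition lemma, Lemma 4.5 of the paper.
Let `f, g ∈ L_0 + L_1` with `f = μ(f)`, `g = μ(g)` and `g ≺≺_tl f`. Then there is a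
collection `{Δ_k}` of pairwise disjoint measurable sets such that on each `Δ_k` the
restrictions of `g` and `f` have equal integrals and `g·χ_{Δ_k} ≺≺_tl f·χ_{Δ_k}`, while
`g ≤ f` on the complement of `⋃ Δ_k` in `(0,∞)`. -/
theorem statement14 (f g : ℝ → ℝ)
    (hf : f ∈ sumSet L0S (LpS 1)) (hg : g ∈ sumSet L0S (LpS 1))
    (hfs : ShapeDR f) (hgs : ShapeDR g) (hmaj : TailMaj g f) :
    ∃ Δ : ℕ → Set ℝ,
      (∀ k, MeasurableSet (Δ k)) ∧
      (∀ k l, k ≠ l → Disjoint (Δ k) (Δ l)) ∧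
      (∀ k, (∫⁻ x in Δ k, ENNReal.ofReal (g x) ∂m0 =
               ∫⁻ x in Δ k, ENNReal.ofReal (f x) ∂m0) ∧
            TailMaj ((Δ k).indicator g) ((Δ k).indicator f)) ∧
      (∀ x ∈ Set.Ioi (0:ℝ) \ ⋃ k, Δ k, g x ≤ f x) := by
  have hfi : ∀ t, 0 < t → IntegrableOn f (Ioi t) := fun t ht => hfs.integrableOn_Ioi hf ht
  have hgi : ∀ t, 0 < t → IntegrableOn g (Ioi t) := fun t ht => hgs.integrableOn_Ioi hg ht
  have hmaj' : ∀ t, 0 < t →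
      ∫⁻ s in Ioi t, ENNReal.ofReal (g s) ≤ ∫⁻ s in Ioi t, ENNReal.ofReal (f s) := by
    intro t ht
    rw [← setLIntegral_mu hgs ht, ← setLIntegral_mu hfs ht]
    exact hmaj t ht
  have : Nonempty {q : ℚ // 0 < q} := ⟨⟨1, one_pos⟩⟩
  obtain ⟨r, hr⟩ := exists_surjective_nat {q : ℚ // 0 < q}
  have hr0 : ∀ k, (0 : ℝ) < (r k : ℚ) := fun k => by exact_mod_cast (r k).2
  obtain ⟨Δ, hΔ, hdisj, hunion⟩ := exists_disjoint_seq
    (D := fun k => minClass (tailDiff f g) ((r k : ℚ) : ℝ))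
    (fun i j => minClass_eq_or_disjoint _ _ _)
  refine ⟨Δ, fun k => ?_, hdisj, fun k => ?_, ?_⟩
  · rcases hΔ k with h | h <;> rw [h]
    · exact MeasurableSet.empty
    · exact (ordConnected_minClass _ _).measurableSet
  · rcases hΔ k with h | h <;> rw [h]
    · refine ⟨by simp, fun t _ => by simp⟩
    · refine ⟨?_, tailMaj_indicator_minClass hfs hgs hfi hgi hmaj' (hr0 k)⟩
      rw [m0, Measure.restrict_restrict (ordConnected_minClass _ _).measurableSet,
        inter_eq_left.2 (minClass_subset _ _)]
      exact setLIntegral_minClass_eq hfs.1 hgs.1 hfi hgi hmaj' _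
  · rintro x ⟨hx, hxΔ⟩
    by_contra! hlt
    obtain ⟨q, hq, hxq⟩ :=
      exists_rat_mem_minClass hfi hgi hx (hfs.2.2 x hx) (hgs.2.2 x hx) hlt
    obtain ⟨k, hk⟩ := hr ⟨q, hq⟩
    rw [hunion] at hxΔ
    exact hxΔ (mem_iUnion.2 ⟨k, by simpa [hk] using hxq⟩)
end
end

section
/- Let p ≥ 1 and let a, b ∈ ℓ^p be sequences such that |b|^p ≺≺_tl |a|^p (tail majorization). Then there exists a linear operator T: ℓ^p → ℓ^p such that T(a) = b, ‖T‖_{ℓ^p→ℓ^p} ≤ 3^{1/p}, and ‖T‖_{ℓ_0→ℓ_0} ≤ 3, where ‖T‖_{ℓ_0→ℓ_0} = sup_u |supp(Tu)|/|supp(u)| over finitely supported sequences u. -/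
open MeasureTheory ENNReal Set Filter

noncomputable section

namespace CSZ

/-- The identification of a sequence `u = (u_k)` with the function `Σ_k u_k 1_{(k,k+1)}`
on `(0,∞)` (the values at the integer points are irrelevant for the measure). -/
def seqToFun (u : ℕ → ℝ) : ℝ → ℝ :=
  fun x => if 0 < x then u ⌊x⌋₊ else 0

/-- The sequence space `ℓ^p`, `0 < p < ∞`. -/
def lpS (p : ℝ) : Set (ℕ → ℝ) :=
  {u | Summable fun n => |u n| ^ p}

/-- The `ℓ^p`-norm. -/
def lpNorm (p : ℝ) (u : ℕ → ℝ) : ℝ :=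
  (∑' n, |u n| ^ p) ^ (1/p)

/-- The sequence space `ℓ^∞`. -/
def linftyS : Set (ℕ → ℝ) :=
  {u | ∃ C : ℝ, ∀ n, |u n| ≤ C}

/-- The `ℓ^∞`-norm. -/
def linftyNorm (u : ℕ → ℝ) : ℝ := ⨆ n, |u n|

/-- The sum `X + Y` of two sets of sequences. -/
def sumSetSeq (X Y : Set (ℕ → ℝ)) : Set (ℕ → ℝ) :=
  {u | ∃ v ∈ X, ∃ w ∈ Y, u = v + w}

/-- A quasi-Banach sequence space: a linear space of sequences equipped with a complete
quasi-norm such that `u ∈ E` and `|v| ≤ |u|` imply `v ∈ E` and `‖v‖_E ≤ ‖u‖_E`. -/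
structure QBSS where
  carrier : Set (ℕ → ℝ)
  qnorm : (ℕ → ℝ) → ℝ
  zero_mem : (0 : ℕ → ℝ) ∈ carrier
  add_mem : ∀ u ∈ carrier, ∀ v ∈ carrier, u + v ∈ carrier
  smul_mem : ∀ (c : ℝ), ∀ u ∈ carrier, c • u ∈ carrier
  qnorm_nonneg : ∀ u, 0 ≤ qnorm u
  qnorm_eq_zero : ∀ u ∈ carrier, qnorm u = 0 → u = 0
  qnorm_smul : ∀ (c : ℝ) (u : ℕ → ℝ), qnorm (c • u) = |c| * qnorm u
  quasi_triangle : ∃ C : ℝ, 1 ≤ C ∧ ∀ u v, qnorm (u + v) ≤ C * (qnorm u + qnorm v)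
  ideal : ∀ u ∈ carrier, ∀ v : ℕ → ℝ,
    (∀ n, |v n| ≤ |u n|) → v ∈ carrier ∧ qnorm v ≤ qnorm u
  complete : ∀ u : ℕ → ℕ → ℝ, (∀ n, u n ∈ carrier) →
    (∀ ε : ℝ, 0 < ε → ∃ N : ℕ, ∀ j ≥ N, ∀ k ≥ N, qnorm (u j - u k) < ε) →
    ∃ v ∈ carrier, ∀ ε : ℝ, 0 < ε → ∃ N : ℕ, ∀ n ≥ N, qnorm (u n - v) < ε

/-- `T` is linear on the subspace `S` of sequences. -/
def IsLinearOnSeq (T : (ℕ → ℝ) → (ℕ → ℝ)) (S : Set (ℕ → ℝ)) : Prop :=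
  (∀ u ∈ S, ∀ v ∈ S, T (u + v) = T u + T v) ∧
  (∀ (c : ℝ), ∀ u ∈ S, T (c • u) = c • T u)

/-- `T` maps `X` into `X` with bound `M` for the (quasi-)norm `N`. -/
def BoundedWithSeq (T : (ℕ → ℝ) → (ℕ → ℝ)) (X : Set (ℕ → ℝ)) (N : (ℕ → ℝ) → ℝ)
    (M : ℝ) : Prop :=
  ∀ u ∈ X, T u ∈ X ∧ N (T u) ≤ M * N u

/-- `T` maps `X` into `X` boundedly for the (quasi-)norm `N`. -/
def BoundedOnSeq (T : (ℕ → ℝ) → (ℕ → ℝ)) (X : Set (ℕ → ℝ)) (N : (ℕ → ℝ) → ℝ) : Prop :=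
  ∃ M : ℝ, 0 ≤ M ∧ BoundedWithSeq T X N M

/-- `(E, NE)` is an interpolation space for the couple of sequence spaces
`((X,NX), (Y,NY))`. -/
def IsInterpolationSeq (X Y : Set (ℕ → ℝ)) (NX NY : (ℕ → ℝ) → ℝ)
    (E : Set (ℕ → ℝ)) (NE : (ℕ → ℝ) → ℝ) : Prop :=
  X ∩ Y ⊆ E ∧ E ⊆ sumSetSeq X Y ∧
  ∀ T : (ℕ → ℝ) → (ℕ → ℝ),
    IsLinearOnSeq T (sumSetSeq X Y) →
    (∀ u ∈ sumSetSeq X Y, T u ∈ sumSetSeq X Y) →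
    BoundedOnSeq T X NX → BoundedOnSeq T Y NY →
    BoundedOnSeq T E NE

end CSZ

namespace CSZ

/-- A bound on `b` by the `ℓ^p`-norm of `a` over `S` yields a functional contractive on `ℓ^p(S)`
sending `a` to `b`; it is extended linearly to all sequences. -/
lemma exists_functional {p : ℝ} (hp : 1 ≤ p) (S : Set ℕ) {a : ℕ → ℝ} (ha : a ∈ lpS p) {b : ℝ}
    (h : |b| ^ p ≤ ∑' n, S.indicator (fun n => |a n| ^ p) n) :
    ∃ φ : (ℕ → ℝ) →ₗ[ℝ] ℝ, φ a = b ∧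
      ∀ u ∈ lpS p, |φ u| ^ p ≤ ∑' n, S.indicator (fun n => |u n| ^ p) n := by
  have hp0 : 0 < p := by linarith
  set q : ℝ≥0∞ := ENNReal.ofReal p with hq
  have hqp : q.toReal = p := ENNReal.toReal_ofReal hp0.le
  have : Fact (1 ≤ q) := ⟨by simpa [hq] using hp⟩
  have hmem (u : ℕ → ℝ) : Memℓp (E := fun _ => ℝ) u q ↔ u ∈ lpS p := by
    rw [memℓp_gen_iff (by rwa [hqp]), hqp]; rfl
  let V : Submodule ℝ (ℕ → ℝ) :=
    { carrier := {u | Memℓp (E := fun _ => ℝ) u q}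
      add_mem' := fun hu hv => Memℓp.add hu hv
      zero_mem' := zero_memℓp
      smul_mem' := fun c _ hu => Memℓp.const_smul hu c }
  have hind (u : ℕ → ℝ) (n : ℕ) :
      |S.indicator u n| ^ p = S.indicator (fun n => |u n| ^ p) n := by
    by_cases hn : n ∈ S <;> simp [hn, hp0.ne']
  let ι : V →ₗ[ℝ] lp (fun _ : ℕ => ℝ) q :=
    { toFun := fun u => ⟨S.indicator u.1, (hmem _).2 <| by
        have hu := (hmem _).1 u.2
        change Summable _
        simp_rw [hind]
        exact Summable.indicator hu S⟩
      map_add' := fun u v => Subtype.ext (Set.indicator_add S u.1 v.1)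
      map_smul' := fun c u => Subtype.ext (Set.indicator_const_smul S c u.1) }
  have hnorm (u : V) : ‖ι u‖ ^ p = ∑' n, S.indicator (fun n => |u.1 n| ^ p) n := by
    have := lp.norm_rpow_eq_tsum (by rwa [hqp]) (ι u)
    rw [hqp] at this
    rw [this]
    exact tsum_congr fun n => hind u.1 n
  let x : V := ⟨a, (hmem a).2 ha⟩
  obtain ⟨g, hg, hgx⟩ := exists_dual_vector'' ℝ (ι x)
  have hbx : |b| ≤ ‖ι x‖ := by
    rw [← Real.rpow_le_rpow_iff (abs_nonneg b) (norm_nonneg _) hp0, hnorm x]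
    exact h
  obtain ⟨φ, hφ⟩ := LinearMap.exists_extend ((b / ‖ι x‖) • (g.toLinearMap ∘ₗ ι))
  have hφ' (u : V) : φ u = b / ‖ι x‖ * g (ι u) := congrArg (fun f => f u) hφ
  refine ⟨φ, ?_, fun u hu => ?_⟩
  · have := hφ' x
    rw [hgx] at this
    rcases eq_or_ne ‖ι x‖ 0 with h0 | h0
    · rw [h0] at hbx
      have hb : b = 0 := abs_nonpos_iff.1 hbx
      simpa [hb] using this
    · rw [show φ a = φ x from rfl, this]
      simp [h0]
  · let y : V := ⟨u, (hmem u).2 hu⟩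
    rw [← hnorm y, show φ u = φ y from rfl, hφ' y, abs_mul, abs_div, abs_norm]
    gcongr
    calc |b| / ‖ι x‖ * |g (ι y)| ≤ 1 * ‖ι y‖ := by
          gcongr
          · exact div_le_one_of_le₀ hbx (norm_nonneg _)
          · exact (g.le_opNorm _).trans (mul_le_of_le_one_left (norm_nonneg _) hg)
      _ = _ := one_mul _

/-- If the tail sums of the antitone sequence `A` dominate those of `B`, each `B m` is bounded by
the sum of `A` over a set `S m`, every index lying in at most three of these sets. The set `S m` is
`{m}` if `B m ≤ A m`; otherwise it collects the intervals between consecutive tail sums of `A` that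
meet the corresponding interval for `B`. -/
lemma exists_cover_of_antitone {A B : ℕ → ℝ} (hA : Antitone A)
    (hB0 : ∀ n, 0 ≤ B n) (hAs : Summable A) (hBs : Summable B)
    (h : ∀ k, ∑' j, B (j + k) ≤ ∑' j, A (j + k)) :
    ∃ S : ℕ → Set ℕ, (∀ n, {m | n ∈ S m}.encard ≤ 3) ∧
      ∀ m, ENNReal.ofReal (B m) ≤ ∑' n, (S m).indicator (fun n => ENNReal.ofReal (A n)) n := by
  set α : ℕ → ℝ := fun k => ∑' j, A (j + k)
  set β : ℕ → ℝ := fun k => ∑' j, B (j + k)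
  have tail {C : ℕ → ℝ} (hC : Summable C) (k : ℕ) :
      ∑' j, C (j + k) = C k + ∑' j, C (j + (k + 1)) := by
    rw [((summable_nat_add_iff k).2 hC).tsum_eq_zero_add]
    simp [add_comm, add_left_comm]
  have hα1 (n) : α n = A n + α (n + 1) := tail hAs n
  have hβ1 (n) : β n = B n + β (n + 1) := tail hBs n
  have hβanti : Antitone β := antitone_nat_of_succ_le fun n => by linarith [hβ1 n, hB0 n]
  have hβ0 (n) : 0 ≤ β n := tsum_nonneg fun j => hB0 _
  have hαlim : Tendsto α atTop (nhds 0) := tendsto_sum_nat_add A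
  set M : ℕ → Set ℕ := fun m => {n | A m < B m ∧ α (n + 1) < β m ∧ β (m + 1) < α n}
  have hle {m n} (hn : n ∈ M m) : m ≤ n := by
    by_contra! hlt
    exact absurd ((h (n + 1)).trans_lt hn.2.1) (not_lt.2 (hβanti hlt))
  have htriple {n m₁ m₂ m₃} (h₁ : n ∈ M m₁) (h₂ : n ∈ M m₂) (h₃ : n ∈ M m₃)
      (h₁₂ : m₁ < m₂) (h₂₃ : m₂ < m₃) : False := by
    have := hβanti (show m₁ + 1 ≤ m₂ from h₁₂)
    have := hβanti (show m₂ + 1 ≤ m₃ from h₂₃)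
    linarith [hA (hle h₂), h₂.1, h₁.2.2, h₃.2.1, hα1 n, hβ1 m₂]
  have htwo (n) : {m | n ∈ M m}.encard ≤ 2 := by
    by_contra! hlt
    have hfin : {m | n ∈ M m}.Finite := (Set.finite_Iic n).subset fun m hm => hle hm
    rw [← hfin.cast_ncard_eq] at hlt
    obtain ⟨x, y, z, hx, hy, hz, hxy, hxz, hyz⟩ :=
      (Set.two_lt_ncard_iff hfin).1 (by exact_mod_cast hlt)
    simp only [Set.mem_ofPred_eq] at hx hy hz
    rcases lt_or_gt_of_ne hxy with h1 | h1 <;> rcases lt_or_gt_of_ne hxz with h2 | h2 <;>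
      rcases lt_or_gt_of_ne hyz with h3 | h3 <;>
      first
        | exact htriple hx hy hz ‹_› ‹_› | exact htriple hx hz hy ‹_› ‹_›
        | exact htriple hy hx hz ‹_› ‹_› | exact htriple hy hz hx ‹_› ‹_›
        | exact htriple hz hx hy ‹_› ‹_› | exact htriple hz hy hx ‹_› ‹_›
  refine ⟨fun m => {n | n = m ∧ B m ≤ A m} ∪ M m, fun n => ?_, fun m => ?_⟩
  · calc _ ≤ ({n} ∪ {m | n ∈ M m} : Set ℕ).encard := by
          refine Set.encard_le_encard fun m hm => ?_
          exact hm.imp (fun h => h.1.symm) id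
      _ ≤ 1 + 2 := (Set.encard_union_le _ _).trans (add_le_add (by simp) (htwo n))
      _ = 3 := by norm_num
  · rcases le_or_gt (B m) (A m) with hm | hm
    · refine (ENNReal.ofReal_le_ofReal hm).trans ?_
      refine le_trans (by simp [hm]) (ENNReal.le_tsum m)
    · have hcover : Ioc (β (m + 1)) (β m) ⊆
          ⋃ n, if n ∈ M m then Ioc (α (n + 1)) (α n) else ∅ := by
        intro x hx
        have hex : ∃ n, α (n + 1) < x := by
          have := (hαlim.comp (tendsto_add_atTop_nat 1)).eventually
            (gt_mem_nhds ((hβ0 _).trans_lt hx.1))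
          exact this.exists
        classical
        have hxle : x ≤ α (Nat.find hex) := by
          rcases hn : Nat.find hex with _ | n
          · exact hx.2.trans ((hβanti (Nat.zero_le m)).trans (h 0))
          · exact not_lt.1 (Nat.find_min hex (m := n) (by omega))
        refine mem_iUnion.2 ⟨Nat.find hex, ?_⟩
        have hfind := Nat.find_spec hex
        rw [if_pos ⟨hm, hfind.trans_le hx.2, hx.1.trans_le hxle⟩]
        exact ⟨hfind, hxle⟩
      have hvol := (measure_mono hcover).trans (measure_iUnion_le (μ := volume) _)
      rw [Real.volume_Ioc, show β m - β (m + 1) = B m by linarith [hβ1 m]] at hvol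
      refine hvol.trans (ENNReal.tsum_le_tsum fun n => ?_)
      by_cases hn : n ∈ M m
      · simp [hn, hα1 n]
      · simp [hn]

/-- A nonnegative null sequence `A` admits a ranking of its support in decreasing order. -/
lemma exists_decreasing_rank {A : ℕ → ℝ} (hA0 : ∀ n, 0 ≤ A n) (hA : Tendsto A atTop (nhds 0)) :
    ∃ r : ℕ → ℕ, InjOn r (Function.support A) ∧
      (∀ n ∈ Function.support A, ∀ s,
        (A n ≤ s → {i | s < A i}.encard ≤ r n) ∧
          (s < A n → (r n : ℕ∞) + 1 ≤ {i | s < A i}.encard)) ∧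
      (∀ k, (¬ ∃ n ∈ Function.support A, r n = k) → (Function.support A).encard ≤ k) := by
  set D : ℕ → Set ℕ := fun n => {i | A n < A i ∨ A i = A n ∧ i < n} with hD
  have hpos {n} (hn : n ∈ Function.support A) : 0 < A n := (hA0 n).lt_of_ne' hn
  have hDfin {n} (hn : n ∈ Function.support A) : (D n).Finite := by
    have := hA.eventually (gt_mem_nhds (hpos hn))
    rw [← Nat.cofinite_eq_atTop] at this
    refine Set.Finite.subset this fun i hi => ?_
    simp only [hD, Set.mem_ofPred_eq, Set.mem_compl_iff, not_lt] at hi ⊢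
    rcases hi with hi | hi
    · linarith
    · linarith [hi.1]
  have hDsupp {n i} (hn : n ∈ Function.support A) (hi : i ∈ D n) : i ∈ Function.support A := by
    have := hpos hn
    refine (ne_of_gt ?_ : A i ≠ 0)
    rcases hi with hi | hi
    · linarith
    · linarith [hi.1]
  set r : ℕ → ℕ := fun n => (D n).ncard with hr
  have hcard {n} (hn : n ∈ Function.support A) : (D n).encard = r n :=
    ((hDfin hn).cast_ncard_eq).symm
  have hnot (n) : n ∉ D n := by simp [hD]
  have hlt {n i} (hn : n ∈ Function.support A) (hi : i ∈ D n) : r i < r n := by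
    refine Set.ncard_lt_ncard (Set.ssubset_iff_of_subset ?_ |>.2 ⟨i, hi, hnot i⟩) (hDfin hn)
    intro j hj
    simp only [hD, Set.mem_ofPred_eq] at hi hj ⊢
    grind
  have htot {n i} (hni : n ≠ i) : n ∈ D i ∨ i ∈ D n := by
    simp only [hD, Set.mem_ofPred_eq]
    grind
  have hinj : InjOn r (Function.support A) := by
    intro n hn i hi hni
    by_contra hne
    rcases htot hne with h | h
    · exact (hlt hi h).ne hni
    · exact (hlt hn h).ne hni.symm
  refine ⟨r, hinj, fun n hn s => ⟨fun hs => ?_, fun hs => ?_⟩, fun k hk => ?_⟩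
  · rw [← hcard hn]
    exact Set.encard_le_encard fun i hi => Or.inl (hs.trans_lt hi)
  · rw [← hcard hn, ← Set.encard_insert_of_notMem (hnot n)]
    refine Set.encard_le_encard fun i hi => ?_
    rcases hi with rfl | hi | hi
    · exact hs
    · exact hs.trans hi
    · exact hs.trans_eq hi.1.symm
  · have hrk : MapsTo r (Function.support A) (Set.Iio k) := by
      intro n hn
      by_contra! hkn
      have hsub : r '' D n = Set.Iio (r n) := by
        refine Set.eq_of_subset_of_ncard_le ?_ ?_ (Set.finite_Iio _)
        · rintro _ ⟨i, hi, rfl⟩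
          exact hlt hn hi
        · rw [(hinj.mono fun i hi => hDsupp hn hi).ncard_image]
          simp [← Finset.coe_Iio, Set.ncard_coe_finset, hr]
      have hkn : k ≤ r n := by simpa using hkn
      rcases hkn.eq_or_lt with h | h
      · exact hk ⟨n, hn, h.symm⟩
      · obtain ⟨i, hi, hik⟩ : k ∈ r '' D n := hsub ▸ h
        exact hk ⟨i, hDsupp hn hi, hik⟩
    calc _ ≤ (Set.Iio k).encard := Set.encard_le_encard_of_injOn hrk hinj
      _ = k := by simp [← Finset.coe_Iio, Set.encard_coe_eq_coe_finsetCard]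

lemma map_floor_m0 : m0.map (fun x : ℝ => ⌊x⌋₊) = Measure.count := by
  refine Measure.ext_of_singleton fun i => ?_
  rw [Measure.map_apply Nat.measurable_floor (measurableSet_singleton i),
    Measure.count_singleton, m0, Measure.restrict_apply
      (Nat.measurable_floor (measurableSet_singleton i))]
  rcases eq_or_ne i 0 with rfl | hi
  · rw [Nat.preimage_floor_zero, Set.inter_comm, Set.Ioi_inter_Iio, Real.volume_Ioo]
    simp
  · rw [Nat.preimage_floor_of_ne_zero hi, Set.inter_eq_left.2, Real.volume_Ico]
    · simp
    · exact fun x hx => (Nat.cast_pos.2 (Nat.pos_of_ne_zero hi)).trans_le hx.1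

lemma m0_lt_abs_seqToFun {A : ℕ → ℝ} (hA0 : ∀ n, 0 ≤ A n) (s : ℝ) :
    m0 {x | s < |seqToFun A x|} = ({i | s < A i}.encard : ℝ≥0∞) := by
  rw [← Measure.count_apply (MeasurableSet.of_discrete), ← map_floor_m0,
    Measure.map_apply Nat.measurable_floor (MeasurableSet.of_discrete)]
  refine measure_congr ?_
  filter_upwards [ae_restrict_mem (μ := volume) (measurableSet_Ioi (a := (0 : ℝ)))] with x hx
  have hx : 0 < x := hx
  refine propext ?_
  change s < |seqToFun A x| ↔ s < A ⌊x⌋₊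
  simp [seqToFun, hx, abs_of_nonneg (hA0 _)]

lemma mu_seqToFun {A : ℕ → ℝ} (hA0 : ∀ n, 0 ≤ A n) {t : ℝ} (ht : 0 ≤ t) :
    mu (seqToFun A) t = sInf {s | 0 ≤ s ∧ {i | s < A i}.encard ≤ ⌊t⌋₊} := by
  unfold mu
  congr 1
  ext s
  refine and_congr_right fun _ => ?_
  rw [m0_lt_abs_seqToFun hA0]
  rcases eq_or_ne {i | s < A i}.encard ⊤ with h | h
  · simp [h]
  · lift {i | s < A i}.encard to ℕ using h with n
    rw [ENat.toENNReal_coe, ← ENNReal.ofReal_natCast, ENNReal.ofReal_le_ofReal_iff ht,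
      Nat.cast_le, Nat.le_floor_iff ht]

/-- The decreasing rearrangement of a nonnegative summable sequence, together with the map sending
each index of the support to its rank. -/
lemma exists_rearrangement {A : ℕ → ℝ} (hA0 : ∀ n, 0 ≤ A n) (hAs : Summable A) :
    ∃ (A' : ℕ → ℝ) (r : ℕ → ℕ), Antitone A' ∧ (∀ k, 0 ≤ A' k) ∧ Summable A' ∧
      (∀ t, 0 ≤ t → mu (seqToFun A) t = A' ⌊t⌋₊) ∧ InjOn r (Function.support A) ∧
      (∀ n ∈ Function.support A, A' (r n) = A n) ∧
      ∀ k, A' k ≠ 0 → ∃ n ∈ Function.support A, r n = k := by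
  obtain ⟨r, hinj, hr, hsupp⟩ := exists_decreasing_rank hA0 hAs.tendsto_atTop_zero
  set L : ℕ → Set ℝ := fun k => {s | 0 ≤ s ∧ {i | s < A i}.encard ≤ k}
  have hLr {n} (hn : n ∈ Function.support A) : L (r n) = Set.Ici (A n) := by
    ext s
    refine ⟨fun hs => ?_, fun hs => ⟨(hA0 n).trans hs, (hr n hn s).1 hs⟩⟩
    by_contra! hlt
    have := ((hr n hn s).2 (not_le.1 hlt)).trans hs.2
    exact absurd (by exact_mod_cast this) (Nat.lt_irrefl (r n))
  have hL0 {k} (hk : ¬ ∃ n ∈ Function.support A, r n = k) : L k = Set.Ici 0 := by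
    ext s
    refine ⟨fun hs => hs.1, fun hs => ⟨hs, le_trans (Set.encard_le_encard fun i hi => ?_)
      (hsupp k hk)⟩⟩
    exact (hs.trans_lt hi).ne'
  have hne (k) : (L k).Nonempty := by
    by_cases hk : ∃ n ∈ Function.support A, r n = k
    · obtain ⟨n, hn, rfl⟩ := hk
      exact hLr hn ▸ Set.nonempty_Ici
    · exact hL0 hk ▸ Set.nonempty_Ici
  have hval : ∀ n ∈ Function.support A, sInf (L (r n)) = A n := fun n hn => by
    rw [hLr hn, csInf_Ici]
  have hzero : ∀ k, sInf (L k) ≠ 0 → ∃ n ∈ Function.support A, r n = k := fun k hk => by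
    by_contra hcon
    exact hk (by rw [hL0 hcon, csInf_Ici])
  refine ⟨fun k => sInf (L k), r, fun k l hkl => ?_, fun k => ?_, ?_, fun t ht => ?_, hinj,
    hval, hzero⟩
  · refine csInf_le_csInf ⟨0, fun s hs => hs.1⟩ (hne k) fun s hs => ⟨hs.1, hs.2.trans ?_⟩
    exact_mod_cast hkl
  · exact le_csInf (hne k) fun s hs => hs.1
  · rw [← (Set.injOn_iff_injective.1 hinj).summable_iff]
    · refine (hAs.subtype (Function.support A)).congr fun n => ?_
      exact (hval n.1 n.2).symm
    · intro k hk
      by_contra hcon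
      obtain ⟨n, hn, rfl⟩ := hzero k hcon
      exact hk ⟨⟨n, hn⟩, rfl⟩
  · exact mu_seqToFun hA0 ht

lemma lintegral_Ioi_mu {A A' : ℕ → ℝ} (h0 : ∀ k, 0 ≤ A' k) (hs : Summable A')
    (h : ∀ t, 0 ≤ t → mu (seqToFun A) t = A' ⌊t⌋₊) (k : ℕ) :
    ∫⁻ s in Set.Ioi (k : ℝ), ENNReal.ofReal (mu (seqToFun A) s) =
      ENNReal.ofReal (∑' j, A' (j + k)) := by
  have hset : Set.Ioi (k : ℝ) =ᵐ[volume]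
      ((fun x : ℝ => ⌊x⌋₊) ⁻¹' Set.Ici k ∩ Set.Ioi 0 : Set ℝ) := by
    rcases Nat.eq_zero_or_pos k with rfl | hk
    · simp
      rfl
    · have hk' : (0 : ℝ) < k := Nat.cast_pos.2 hk
      have heq : Set.Ici (k : ℝ) = (fun x : ℝ => ⌊x⌋₊) ⁻¹' Set.Ici k ∩ Set.Ioi 0 := by
        ext x
        simp only [Set.mem_Ici, Set.mem_inter_iff, Set.mem_preimage, Set.mem_Ioi]
        exact ⟨fun hx => ⟨Nat.le_floor hx, hk'.trans_le hx⟩,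
          fun hx => (Nat.le_floor_iff hx.2.le).1 hx.1⟩
      exact heq ▸ Ioi_ae_eq_Ici
  calc _ = ∫⁻ s in Set.Ioi (k : ℝ), ENNReal.ofReal (A' ⌊s⌋₊) := by
        refine setLIntegral_congr_fun measurableSet_Ioi fun s hs => ?_
        rw [h s ((Nat.cast_nonneg k).trans (le_of_lt hs))]
    _ = ∫⁻ s in (fun x : ℝ => ⌊x⌋₊) ⁻¹' Set.Ici k, ENNReal.ofReal (A' ⌊s⌋₊) ∂m0 := by
        rw [m0, Measure.restrict_restrict (Nat.measurable_floor MeasurableSet.of_discrete)]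
        exact setLIntegral_congr hset
    _ = ∑' i, (Set.Ici k).indicator (fun i => ENNReal.ofReal (A' i)) i := by
        rw [← setLIntegral_map (f := fun i => ENNReal.ofReal (A' i)) MeasurableSet.of_discrete
          (measurable_of_countable _) Nat.measurable_floor, map_floor_m0,
          ← lintegral_indicator MeasurableSet.of_discrete, lintegral_count]
    _ = ∑' j, ENNReal.ofReal (A' (j + k)) := by
        rw [← ENNReal.summable.sum_add_tsum_nat_add' (k := k), Finset.sum_eq_zero, zero_add]
        · simp
        · intro i hi
          exact Set.indicator_of_notMem (by simpa using hi) _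
    _ = _ := (ENNReal.ofReal_tsum_of_nonneg (fun j => h0 _) ((summable_nat_add_iff k).2 hs)).symm

lemma TailMaj.lintegral_Ioi_zero_le {g f : ℝ → ℝ} (h : TailMaj g f) :
    ∫⁻ s in Set.Ioi 0, ENNReal.ofReal (mu g s) ≤ ∫⁻ s in Set.Ioi 0, ENNReal.ofReal (mu f s) := by
  have hU : Set.Ioi (0 : ℝ) = ⋃ n : ℕ, Set.Ioi (1 / ((n : ℝ) + 1)) := by
    ext x
    simp only [Set.mem_Ioi, Set.mem_iUnion]
    exact ⟨exists_nat_one_div_lt, fun ⟨n, hn⟩ => Nat.one_div_pos_of_nat.trans hn⟩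
  have hmono : Monotone fun n : ℕ => Set.Ioi (1 / ((n : ℝ) + 1)) := fun n m hnm =>
    Set.Ioi_subset_Ioi (Nat.one_div_le_one_div hnm)
  nth_rw 1 [hU]
  rw [← withDensity_apply _ (MeasurableSet.iUnion fun n => measurableSet_Ioi),
    hmono.measure_iUnion]
  refine iSup_le fun n => ?_
  rw [withDensity_apply _ measurableSet_Ioi]
  exact (h _ Nat.one_div_pos_of_nat).trans
    (lintegral_mono_set (Set.Ioi_subset_Ioi Nat.one_div_pos_of_nat.le))

lemma TailMaj.tsum_nat_add_le {A B A' B' : ℕ → ℝ} (hAB : TailMaj (seqToFun B) (seqToFun A))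
    (hA0 : ∀ k, 0 ≤ A' k) (hAs : Summable A') (hA : ∀ t, 0 ≤ t → mu (seqToFun A) t = A' ⌊t⌋₊)
    (hB0 : ∀ k, 0 ≤ B' k) (hBs : Summable B') (hB : ∀ t, 0 ≤ t → mu (seqToFun B) t = B' ⌊t⌋₊)
    (k : ℕ) : ∑' j, B' (j + k) ≤ ∑' j, A' (j + k) := by
  rw [← ENNReal.ofReal_le_ofReal_iff (tsum_nonneg fun j => hA0 _),
    ← lintegral_Ioi_mu hA0 hAs hA, ← lintegral_Ioi_mu hB0 hBs hB]
  rcases Nat.eq_zero_or_pos k with rfl | hk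
  · simpa using hAB.lintegral_Ioi_zero_le
  · exact hAB k (Nat.cast_pos.2 hk)

/-- Tail majorization of `B` by `A` bounds each `B m` by the sum of `A` over a set `S m`, every
index lying in at most three of these sets. -/
lemma exists_cover {A B : ℕ → ℝ} (hA0 : ∀ n, 0 ≤ A n) (hB0 : ∀ n, 0 ≤ B n)
    (hAs : Summable A) (hBs : Summable B) (hAB : TailMaj (seqToFun B) (seqToFun A)) :
    ∃ S : ℕ → Set ℕ, (∀ n, {m | n ∈ S m}.encard ≤ 3) ∧
      ∀ m, B m ≤ ∑' n, (S m).indicator A n := by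
  obtain ⟨A', r, hA', hA'0, hA's, hAmu, -, hAr, hAr'⟩ := exists_rearrangement hA0 hAs
  obtain ⟨B', q, -, hB'0, hB's, hBmu, hqinj, hBq, -⟩ := exists_rearrangement hB0 hBs
  obtain ⟨S, hS3, hS⟩ := exists_cover_of_antitone hA' hB'0 hA's hB's
    (hAB.tsum_nat_add_le hA'0 hA's hAmu hB'0 hB's hBmu)
  refine ⟨fun m => {n | m ∈ Function.support B ∧ n ∈ Function.support A ∧ r n ∈ S (q m)},
    fun n => ?_, fun m => ?_⟩
  · refine le_trans ?_ (hS3 (r n))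
    exact Set.encard_le_encard_of_injOn (f := q) (fun m hm => hm.2.2)
      (hqinj.mono fun m hm => hm.1)
  · set U := {n | m ∈ Function.support B ∧ n ∈ Function.support A ∧ r n ∈ S (q m)}
    have hU0 : 0 ≤ ∑' n, U.indicator A n := tsum_nonneg fun n => Set.indicator_nonneg
      (fun n _ => hA0 n) n
    by_cases hm : m ∈ Function.support B
    swap
    · rwa [Function.notMem_support.1 hm]
    rw [← ENNReal.ofReal_le_ofReal_iff hU0, ← hBq m hm]
    refine (hS (q m)).trans ?_
    have hex : ∀ k : (S (q m) ∩ Function.support A' : Set ℕ), ∃ n ∈ Function.support A, r n = k :=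
      fun k => hAr' k k.2.2
    choose e he her using hex
    have heinj : Function.Injective e := fun k l hkl => Subtype.ext (by rw [← her, ← her, hkl])
    rw [ENNReal.ofReal_tsum_of_nonneg (fun n => Set.indicator_nonneg (fun n _ => hA0 n) n)
      (hAs.indicator U)]
    calc _ = ∑' k, (S (q m) ∩ Function.support A').indicator
            (fun k => ENNReal.ofReal (A' k)) k := by
          refine tsum_congr fun k => ?_
          by_cases hk : A' k = 0 <;> by_cases hkS : k ∈ S (q m) <;> simp [hk, hkS]
      _ = ∑' k : (S (q m) ∩ Function.support A' : Set ℕ), ENNReal.ofReal (A' k) :=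
          (tsum_subtype _ _).symm
      _ = ∑' k, ENNReal.ofReal (U.indicator A (e k)) := by
          refine tsum_congr fun k => ?_
          have : e k ∈ U := ⟨hm, he k, (her k).symm ▸ k.2.1⟩
          rw [Set.indicator_of_mem this, ← hAr _ (he k), her]
      _ ≤ _ := ENNReal.tsum_comp_le_tsum_of_injective heinj _

end CSZ

open CSZ MeasureTheory ENNReal Set in
/-- sequence operator lemma, Lemma 6.2 of the paper.
Let `p ≥ 1` and `a, b ∈ ℓ^p` with `|b|^p ≺≺_tl |a|^p` (tail majorization, through the
identification of sequences with functions on `(0,∞)`). Then there is a linear operator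
`T : ℓ^p → ℓ^p` with `T a = b`, `‖T‖_{ℓ^p→ℓ^p} ≤ 3^{1/p}` and `‖T‖_{ℓ_0→ℓ_0} ≤ 3`
(i.e. `|supp(Tu)| ≤ 3·|supp(u)|` for every finitely supported `u`). -/
theorem statement19 (p : ℝ) (hp : 1 ≤ p) (a b : ℕ → ℝ)
    (ha : a ∈ lpS p) (hb : b ∈ lpS p)
    (hmaj : TailMaj (seqToFun fun n => |b n| ^ p) (seqToFun fun n => |a n| ^ p)) :
    ∃ T : (ℕ → ℝ) → (ℕ → ℝ),
      (∀ u v : ℕ → ℝ, T (u + v) = T u + T v) ∧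
      (∀ (c : ℝ) (u : ℕ → ℝ), T (c • u) = c • T u) ∧
      T a = b ∧
      (∀ u ∈ lpS p, T u ∈ lpS p ∧ lpNorm p (T u) ≤ 3 ^ (1/p) * lpNorm p u) ∧
      (∀ u : ℕ → ℝ, (Function.support u).Finite →
        (Function.support (T u)).Finite ∧
        (Function.support (T u)).ncard ≤ 3 * (Function.support u).ncard) := by
  have hp0 : 0 < p := by linarith
  obtain ⟨S, hS3, hS⟩ := exists_cover (fun n => by positivity) (fun n => by positivity) ha hb hmaj
  choose φ hφa hφ using fun m => exists_functional hp (S m) ha (hS m)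
  have hnonneg (u : ℕ → ℝ) (m n : ℕ) : 0 ≤ (S m).indicator (fun n => |u n| ^ p) n :=
    Set.indicator_nonneg (fun n _ => by positivity) n
  refine ⟨fun u m => φ m u, fun u v => funext fun m => map_add _ _ _,
    fun c u => funext fun m => map_smul _ _ _, funext hφa, fun u hu => ?_, fun u hu => ?_⟩
  · have hu : Summable fun n => |u n| ^ p := hu
    have hu0 : 0 ≤ ∑' n, |u n| ^ p := tsum_nonneg fun n => by positivity
    have key : ∑' m, ENNReal.ofReal (|φ m u| ^ p) ≤ ENNReal.ofReal (3 * ∑' n, |u n| ^ p) := by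
      calc _ ≤ ∑' m, ∑' n, ENNReal.ofReal ((S m).indicator (fun n => |u n| ^ p) n) := by
            refine ENNReal.tsum_le_tsum fun m => ?_
            rw [← ENNReal.ofReal_tsum_of_nonneg (hnonneg u m) (hu.indicator _)]
            exact ENNReal.ofReal_le_ofReal (hφ m u hu)
        _ = ∑' n, ∑' m, ENNReal.ofReal ((S m).indicator (fun n => |u n| ^ p) n) :=
            ENNReal.tsum_comm
        _ = ∑' n, ({m | n ∈ S m}.encard : ℝ≥0∞) * ENNReal.ofReal (|u n| ^ p) := by
            refine tsum_congr fun n => ?_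
            rw [← ENNReal.tsum_set_const, tsum_subtype {m | n ∈ S m}
              (fun _ => ENNReal.ofReal (|u n| ^ p))]
            refine tsum_congr fun m => ?_
            by_cases hm : n ∈ S m <;> simp [hm]
        _ ≤ ∑' n, 3 * ENNReal.ofReal (|u n| ^ p) := by
            refine ENNReal.tsum_le_tsum fun n => ?_
            gcongr
            exact_mod_cast ENat.toENNReal_mono (hS3 n)
        _ = _ := by
            rw [ENNReal.tsum_mul_left, ENNReal.ofReal_mul (by norm_num),
              ENNReal.ofReal_tsum_of_nonneg (fun n => by positivity) hu]
            simp
    have hsum : Summable fun m => |φ m u| ^ p := by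
      refine (ENNReal.summable_toReal (key.trans_lt ENNReal.ofReal_lt_top).ne).congr fun m => ?_
      exact ENNReal.toReal_ofReal (by positivity)
    refine ⟨hsum, ?_⟩
    rw [← ENNReal.ofReal_tsum_of_nonneg (fun m => by positivity) hsum,
      ENNReal.ofReal_le_ofReal_iff (by positivity)] at key
    unfold CSZ.lpNorm
    rw [← Real.mul_rpow (by norm_num) hu0]
    exact Real.rpow_le_rpow (tsum_nonneg fun m => by positivity) key (by positivity)
  · have hup : u ∈ lpS p := by
      refine summable_of_hasFiniteSupport (hu.subset fun n hn => ?_)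
      contrapose! hn
      simp [Function.notMem_support.1 hn, hp0.ne']
    have hsub : Function.support (fun m => φ m u) ⊆
        ⋃ n ∈ hu.toFinset, {m | n ∈ S m} := by
      intro m hm
      by_contra hcon
      simp only [Set.mem_iUnion, not_exists] at hcon
      have hz : ∀ n, (S m).indicator (fun n => |u n| ^ p) n = 0 := fun n => by
        by_cases hn : n ∈ S m
        · have : u n = 0 := by
            by_contra hun
            exact hcon n (hu.mem_toFinset.2 hun) hn
          simp [this, hp0.ne']
        · simp [hn]
      have := hφ m u hup
      rw [tsum_congr hz, tsum_zero] at this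
      exact absurd (Real.rpow_pos_of_pos (abs_pos.2 hm) p) (not_lt.2 this)
    have hcard : (Function.support fun m => φ m u).encard ≤
        (3 * (Function.support u).ncard : ℕ) := by
      calc _ ≤ (⋃ n ∈ hu.toFinset, {m | n ∈ S m}).encard := Set.encard_le_encard hsub
        _ ≤ ∑ n ∈ hu.toFinset, {m | n ∈ S m}.encard := Finset.set_encard_biUnion_le _ _
        _ ≤ ∑ n ∈ hu.toFinset, 3 := Finset.sum_le_sum fun n _ => hS3 n
        _ = _ := by
          rw [Set.ncard_eq_toFinset_card _ hu]
          simp [mul_comm]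
    have hfin := Set.finite_of_encard_le_coe hcard
    refine ⟨hfin, ?_⟩
    rw [← hfin.cast_ncard_eq] at hcard
    exact_mod_cast hcard
end
end
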